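/- arXiv:2007.03523 — 2 statements merged into one kernel-verified Lean document; each statement's English description precedes it below -/
import Mathlib

section
/- Let k, l, n, m be nonnegative integers. Suppose S* ⊂ ℝⁿ is a Borel countably k-rectifiable set and S ⊂ ℝ^m is a Borel set that is a countable union of l-rectifiable sets. Then for every Borel function g : ℝⁿ × ℝ^m → [0,∞], one has ∫_{S* × S} g(x,y) dH^{k+l}(x,y) = ∫_{S*} ∫_{S} g(x,y) dH^l(y) dH^k(x), where H^{k+l} is (k+l)-dimensional Hausdorff measure on ℝⁿ × ℝ^m and H^k, H^l are the Hausdorff measures on ℝⁿ and ℝ^m respectively. -/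
open MeasureTheory

/-- A set `S` in a metric space `E` is `k`-rectifiable if it is contained in the image of a
subset of `ℝᵏ` under a Lipschitz map `ℝᵏ → E`. -/
def IsRectifiable (k : ℕ) {E : Type*} [PseudoEMetricSpace E] (S : Set E) : Prop :=
  ∃ (f : EuclideanSpace ℝ (Fin k) → E) (K : NNReal) (A : Set (EuclideanSpace ℝ (Fin k))),
    LipschitzWith K f ∧ S ⊆ f '' A

/-- A set `S` is countably `k`-rectifiable if `H^k`-almost all of `S` is contained in a
countable union of `k`-rectifiable sets. -/
def IsCountablyRectifiable (k : ℕ) {E : Type*} [EMetricSpace E] [MeasurableSpace E]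
    [BorelSpace E] (S : Set E) : Prop :=
  ∃ T : ℕ → Set E, (∀ i, IsRectifiable k (T i)) ∧ μH[(k : ℝ)] (S \ ⋃ i, T i) = 0

section

open Set Filter Topology Metric Module
open scoped ENNReal NNReal Pointwise

/-- A closed bounded set with nonempty interior in a finite-dimensional normed space has
top-dimensional Hausdorff measure at most the corresponding power of its diameter. -/
lemma hausdorffMeasure_finrank_le_ediam_rpow_of_isClosed {V : Type*} [NormedAddCommGroup V]
    [NormedSpace ℝ V] [FiniteDimensional ℝ V] [MeasurableSpace V] [BorelSpace V] {K : Set V}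
    (hK : IsClosed K) (hint : (interior K).Nonempty) (hbdd : Bornology.IsBounded K) :
    μH[finrank ℝ V] K ≤ ediam K ^ (finrank ℝ V : ℝ) := by
  set d := finrank ℝ V with hd
  set μ : Measure V := μH[finrank ℝ V] with hμ
  obtain ⟨x₀, hx₀⟩ := hint
  have hx₀K : x₀ ∈ K := interior_subset hx₀
  have hKpos : 0 < μ K := (isOpen_interior.measure_pos μ ⟨x₀, hx₀⟩).trans_le
    (measure_mono interior_subset)
  have hKfin : μ K ≠ ∞ := hbdd.measure_lt_top.ne
  set D := diam K with hD
  have hD0 : 0 ≤ D := diam_nonneg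
  have hediam : ediam K = ENNReal.ofReal D := (ENNReal.ofReal_toReal hbdd.ediam_ne_top).symm
  let B : V × ℝ → Set V := fun p => (p.1 - p.2 • x₀) +ᵥ (p.2 • K)
  have hBμ : ∀ p : V × ℝ, 0 ≤ p.2 → μ (B p) = ENNReal.ofReal (p.2 ^ d) * μ K := by
    intro p hp
    simp only [B, measure_vadd]
    rw [Measure.addHaar_smul_of_nonneg μ hp]
  have hBdiam : ∀ p : V × ℝ, 0 ≤ p.2 → ediam (B p) = ENNReal.ofReal (p.2 * D) := by
    intro p hp
    simp only [B]
    rw [ediam_vadd, ediam_smul₀, hediam, ENNReal.ofReal_mul hp, ENNReal.smul_def, smul_eq_mul]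
    congr 1
    exact Real.enorm_of_nonneg hp
  have hBball : ∀ p : V × ℝ, 0 ≤ p.2 → B p ⊆ closedBall p.1 (p.2 * D) := by
    rintro p hp _ ⟨_, ⟨y, hy, rfl⟩, rfl⟩
    have : dist y x₀ ≤ D := dist_le_diam_of_mem hbdd hy hx₀K
    rw [mem_closedBall, dist_eq_norm]
    have h2 : ((p.1 - p.2 • x₀) +ᵥ p.2 • y) - p.1 = p.2 • (y - x₀) := by
      simp only [vadd_eq_add, smul_sub]; abel
    change ‖((p.1 - p.2 • x₀) +ᵥ p.2 • y) - p.1‖ ≤ _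
    rw [h2, norm_smul, Real.norm_of_nonneg hp, ← dist_eq_norm]
    gcongr
  set U : Set V := ball 0 1
  have hUpos : 0 < μ U := measure_ball_pos μ 0 one_pos
  have hUfin : μ U ≠ ∞ := measure_ball_lt_top.ne
  -- the doubling constant
  set C : ℝ≥0 := ((ENNReal.ofReal ((3 * D) ^ d) * μ U) / μ K).toNNReal with hC
  have hCe : (C : ℝ≥0∞) = (ENNReal.ofReal ((3 * D) ^ d) * μ U) / μ K :=
    ENNReal.coe_toNNReal (ENNReal.div_ne_top (ENNReal.mul_ne_top ENNReal.ofReal_ne_top hUfin)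
      hKpos.ne')
  have key : ∀ n : ℕ, ∃ u : Set (V × ℝ), u.Countable ∧ (∀ p ∈ u, 0 < p.2) ∧
      (∀ p ∈ u, p.2 * D ≤ 1 / ((n : ℝ) + 1)) ∧ (∀ p ∈ u, B p ⊆ U) ∧ u.PairwiseDisjoint B ∧
      μ (U \ ⋃ p ∈ u, B p) = 0 := by
    intro n
    have hn : (0 : ℝ) < 1 / ((n : ℝ) + 1) := Nat.one_div_pos_of_nat
    obtain ⟨u, hut, hc, hdisj, hcov⟩ := Vitali.exists_disjoint_covering_ae μ U
      {p : V × ℝ | 0 < p.2 ∧ p.2 * D ≤ 1 / ((n : ℝ) + 1) ∧ closedBall p.1 (p.2 * D) ⊆ U} C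
      (fun p => p.2 * D) Prod.fst B (fun p hp => hBball p hp.1.le) (fun p hp => by
        rw [hBμ p hp.1.le, Measure.addHaar_closedBall μ _ (by have := hp.1.le; positivity), hCe]
        have : 3 * (p.2 * D) = p.2 * (3 * D) := by ring
        rw [this, mul_pow, ENNReal.ofReal_mul (by have := hp.1.le; positivity)]
        rw [mul_comm (ENNReal.ofReal (p.2 ^ d)) (μ K), ← mul_assoc,
          ENNReal.div_mul_cancel hKpos.ne' hKfin, mul_comm _ (ENNReal.ofReal (p.2 ^ d)), mul_assoc])
      (fun p hp => by
        simp only [B]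
        rw [interior_vadd, interior_smul₀ hp.1.ne']
        exact (Set.Nonempty.smul_set ⟨x₀, hx₀⟩).vadd_set)
      (fun p hp => (hK.smul_of_ne_zero hp.1.ne').vadd _)
      (fun x hx ε hε => by
        obtain ⟨δ, hδ, hδU⟩ := Metric.nhds_basis_closedBall.mem_iff.1 (isOpen_ball.mem_nhds hx)
        set η := min (min ε δ) (1 / ((n : ℝ) + 1)) with hη
        have hη0 : 0 < η := lt_min (lt_min hε hδ) hn
        have hle : η / (D + 1) * D ≤ η := by
          rw [div_mul_eq_mul_div, div_le_iff₀ (by positivity)]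
          nlinarith
        refine ⟨(x, η / (D + 1)), ⟨by positivity, hle.trans (min_le_right _ _), ?_⟩,
          hle.trans ((min_le_left _ _).trans (min_le_left _ _)), rfl⟩
        exact (closedBall_subset_closedBall
          (hle.trans ((min_le_left _ _).trans (min_le_right _ _)))).trans hδU)
    exact ⟨u, hc, fun p hp => (hut hp).1, fun p hp => (hut hp).2.1,
      fun p hp => (hBball p (hut hp).1.le).trans (hut hp).2.2, hdisj, hcov⟩
  choose u hc hpos hsmall hsub hdisj hcov using key
  have : ∀ n, Countable (u n) := fun n => (hc n).to_subtype
  set N : Set V := ⋃ n, (U \ ⋃ p ∈ u n, B p) with hN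
  have hN0 : μ N = 0 := measure_iUnion_null hcov
  have hUle : μ U ≤ ENNReal.ofReal D ^ d / μ K * μ U := by
    calc μ U = μ (U \ N) := (measure_sdiff_null hN0).symm
      _ ≤ liminf (fun n => ∑' p : u n, ediam (B p) ^ (d : ℝ)) atTop := by
        refine Measure.hausdorffMeasure_le_liminf_tsum (d : ℝ) (U \ N)
          (fun n : ℕ => ENNReal.ofReal (1 / ((n : ℝ) + 1))) ?_
          (fun n (p : u n) => B p) (Eventually.of_forall fun n p => ?_)
          (Eventually.of_forall fun n x hx => ?_)
        · rw [← ENNReal.ofReal_zero]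
          exact ENNReal.tendsto_ofReal tendsto_one_div_add_atTop_nhds_zero_nat
        · rw [hBdiam p (hpos n p p.2).le]
          exact ENNReal.ofReal_le_ofReal (hsmall n p p.2)
        · by_contra hcon
          refine hx.2 (mem_iUnion.2 ⟨n, hx.1, ?_⟩)
          rwa [biUnion_eq_iUnion]
      _ ≤ liminf (fun _ : ℕ => ENNReal.ofReal D ^ d / μ K * μ U) atTop := by
        refine liminf_le_liminf (Eventually.of_forall fun n => ?_)
        calc ∑' p : u n, ediam (B p) ^ (d : ℝ)
            = ∑' p : u n, ENNReal.ofReal D ^ d / μ K * μ (B p) := by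
              refine tsum_congr fun p => ?_
              have hp := (hpos n p p.2).le
              rw [hBdiam p hp, hBμ p hp, ENNReal.rpow_natCast, ENNReal.ofReal_mul hp, mul_pow,
                ← ENNReal.ofReal_pow hp, mul_comm (ENNReal.ofReal _) (μ K), ← mul_assoc,
                ENNReal.div_mul_cancel hKpos.ne' hKfin, mul_comm]
          _ = ENNReal.ofReal D ^ d / μ K * μ (⋃ p ∈ u n, B p) := by
              rw [ENNReal.tsum_mul_left, measure_biUnion (hc n) (hdisj n)]
              intro p hp
              exact ((hK.smul_of_ne_zero (hpos n p hp).ne').vadd _).measurableSet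
          _ ≤ ENNReal.ofReal D ^ d / μ K * μ U := by
              gcongr
              exact iUnion₂_subset (hsub n)
      _ = ENNReal.ofReal D ^ d / μ K * μ U := liminf_const _
  have h1 : 1 ≤ ENNReal.ofReal D ^ d / μ K := by
    by_contra! hlt
    have := ENNReal.mul_lt_mul_left hUpos.ne' hUfin hlt
    rw [one_mul] at this
    exact absurd hUle this.not_ge
  rw [hediam, ENNReal.rpow_natCast]
  simpa using (ENNReal.le_div_iff_mul_le (Or.inl hKpos.ne') (Or.inl hKfin)).1 h1

/-- In a finite-dimensional normed space, the top-dimensional Hausdorff measure of a set is at most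
the corresponding power of its diameter. -/
lemma hausdorffMeasure_finrank_le_ediam_rpow {V : Type*} [NormedAddCommGroup V]
    [NormedSpace ℝ V] [FiniteDimensional ℝ V] [MeasurableSpace V] [BorelSpace V] (s : Set V) :
    μH[finrank ℝ V] s ≤ ediam s ^ (finrank ℝ V : ℝ) := by
  by_cases htop : ediam s = ∞
  · rcases Nat.eq_zero_or_pos (finrank ℝ V) with h0 | hpos
    · have : Subsingleton V := finrank_zero_iff.1 h0
      simp [ediam_subsingleton (subsingleton_of_subsingleton (s := s))] at htop
    · rw [htop, ENNReal.top_rpow_of_pos (by exact_mod_cast hpos)]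
      exact le_top
  set K := closure (convexHull ℝ s) with hK
  have hdiam : ediam K = ediam s := by rw [hK, ediam_closure, convexHull_ediam]
  have hsK : s ⊆ K := (subset_convexHull ℝ s).trans subset_closure
  have hconv : Convex ℝ K := (convex_convexHull ℝ s).closure
  rw [← hdiam]
  refine (measure_mono hsK).trans ?_
  rcases (interior K).eq_empty_or_nonempty with he | hne
  · have : K ⊆ frontier K := by
      rw [isClosed_closure.frontier_eq, he, sdiff_empty]
    rw [measure_mono_null this (hconv.addHaar_frontier _)]
    exact zero_le
  · exact hausdorffMeasure_finrank_le_ediam_rpow_of_isClosed isClosed_closure hne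
      (isBounded_iff_ediam_ne_top.2 (hdiam ▸ htop))

/-- In a finite-dimensional normed space, there are sets of diameter at most one whose
top-dimensional Hausdorff measure is arbitrarily close to one. -/
lemma exists_ediam_le_one_lt_mul_hausdorffMeasure {V : Type*} [NormedAddCommGroup V]
    [NormedSpace ℝ V] [FiniteDimensional ℝ V] [MeasurableSpace V] [BorelSpace V] {θ : ℝ≥0}
    (hθ : 1 < θ) : ∃ s : Set V, ediam s ≤ 1 ∧ 1 ≤ θ * μH[finrank ℝ V] s := by
  obtain ⟨s, hs1, hs⟩ : ∃ s : Set V, ediam s ≤ 1 ∧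
      ediam s ^ (finrank ℝ V : ℝ) < θ * μH[finrank ℝ V] s := by
    by_contra! hcon
    have hle : (θ • μH[finrank ℝ V] : Measure V) ≤ μH[finrank ℝ V] :=
      Measure.le_hausdorffMeasure _ _ 1 one_pos hcon
    have hpos : 0 < (μH[finrank ℝ V] : Measure V) (ball 0 1) := measure_ball_pos _ 0 one_pos
    have hfin : (μH[finrank ℝ V] : Measure V) (ball 0 1) ≠ ∞ := measure_ball_lt_top.ne
    have hball : (θ : ℝ≥0∞) * μH[finrank ℝ V] (ball (0 : V) 1) ≤ μH[finrank ℝ V] (ball (0 : V) 1) :=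
      hle (ball 0 1)
    have := ENNReal.mul_lt_mul_left hpos.ne' hfin (show (1 : ℝ≥0∞) < θ by exact_mod_cast hθ)
    rw [one_mul] at this
    exact absurd hball this.not_ge
  rcases eq_or_ne (ediam s) 0 with h0 | h0
  · rcases Nat.eq_zero_or_pos (finrank ℝ V) with hd | hd
    · refine ⟨s, hs1, ?_⟩
      rw [h0, hd, Nat.cast_zero, ENNReal.rpow_zero] at hs
      rw [hd, Nat.cast_zero]
      exact hs.le
    · have := hausdorffMeasure_finrank_le_ediam_rpow s
      rw [h0, ENNReal.zero_rpow_of_pos (by exact_mod_cast hd), nonpos_iff_eq_zero] at this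
      rw [this, mul_zero] at hs
      exact absurd hs not_lt_zero
  · have hfin : ediam s ≠ ∞ := (hs1.trans_lt ENNReal.one_lt_top).ne
    obtain ⟨D, hD⟩ : ∃ D : ℝ≥0, (D : ℝ≥0∞) = ediam s := ⟨_, ENNReal.coe_toNNReal hfin⟩
    have hD0 : D ≠ 0 := by rintro rfl; exact h0 hD.symm
    rw [← hD, ENNReal.rpow_natCast] at hs
    refine ⟨D⁻¹ • s, ?_, ?_⟩
    · rw [NNReal.smul_def, ediam_smul₀, ← hD, ENNReal.smul_def, smul_eq_mul, ← ENNReal.coe_mul]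
      simp [hD0]
    · rw [Measure.addHaar_nnreal_smul, mul_left_comm]
      have hp : (D : ℝ≥0∞) ^ finrank ℝ V ≠ 0 := by simp [hD0]
      calc (1 : ℝ≥0∞) = ((D⁻¹ : ℝ≥0) : ℝ≥0∞) ^ finrank ℝ V * (D : ℝ≥0∞) ^ finrank ℝ V := by
            rw [← mul_pow, ← ENNReal.coe_mul, inv_mul_cancel₀ hD0]; simp
        _ ≤ _ := by gcongr

/-- Projections of a set do not increase its diameter, for the sup distance. -/
lemma ediam_image_fst_le {X Y : Type*} [PseudoEMetricSpace X] [PseudoEMetricSpace Y]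
    (s : Set (X × Y)) : ediam (Prod.fst '' s) ≤ ediam s :=
  ediam_image_le_iff.2 fun _ hx _ hy => (le_max_left _ _).trans (edist_le_ediam_of_mem hx hy)

lemma ediam_image_snd_le {X Y : Type*} [PseudoEMetricSpace X] [PseudoEMetricSpace Y]
    (s : Set (X × Y)) : ediam (Prod.snd '' s) ≤ ediam s :=
  ediam_image_le_iff.2 fun _ hx _ hy => (le_max_right _ _).trans (edist_le_ediam_of_mem hx hy)

lemma ediam_prod_le {X Y : Type*} [PseudoEMetricSpace X] [PseudoEMetricSpace Y]
    (s : Set X) (t : Set Y) : ediam (s ×ˢ t) ≤ max (ediam s) (ediam t) :=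
  ediam_le fun _ hx _ hy => max_le_max (edist_le_ediam_of_mem hx.1 hy.1)
    (edist_le_ediam_of_mem hx.2 hy.2)

/-- In finite-dimensional normed spaces, the top-dimensional Hausdorff measure of a product
(with the sup norm) is the product of the top-dimensional Hausdorff measures. -/
lemma hausdorffMeasure_finrank_prod {V W : Type*}
    [NormedAddCommGroup V] [NormedSpace ℝ V] [FiniteDimensional ℝ V] [MeasurableSpace V]
    [BorelSpace V] [NormedAddCommGroup W] [NormedSpace ℝ W] [FiniteDimensional ℝ W]
    [MeasurableSpace W] [BorelSpace W] :
    (μH[finrank ℝ (V × W)] : Measure (V × W)) =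
      (μH[finrank ℝ V] : Measure V).prod (μH[finrank ℝ W] : Measure W) := by
  set P := (μH[finrank ℝ V] : Measure V).prod (μH[finrank ℝ W] : Measure W) with hP
  have hcast : (finrank ℝ (V × W) : ℝ) = finrank ℝ V + finrank ℝ W := by
    rw [finrank_prod, Nat.cast_add]
  refine le_antisymm ?_ ?_
  · have hc := Measure.isAddLeftInvariant_eq_smul (μH[finrank ℝ (V × W)] : Measure (V × W)) P
    set c := Measure.addHaarScalarFactor (μH[finrank ℝ (V × W)] : Measure (V × W)) P
    have hcle : c ≤ 1 := by
      have h : ∀ θ : ℝ≥0, 1 < θ → c ≤ θ * θ := by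
        intro θ hθ
        obtain ⟨s, hs, hs'⟩ := exists_ediam_le_one_lt_mul_hausdorffMeasure (V := V) hθ
        obtain ⟨t, ht, ht'⟩ := exists_ediam_le_one_lt_mul_hausdorffMeasure (V := W) hθ
        have h1 : (c : ℝ≥0∞) * (μH[finrank ℝ V] s * μH[finrank ℝ W] t) ≤ 1 := by
          calc (c : ℝ≥0∞) * (μH[finrank ℝ V] s * μH[finrank ℝ W] t) = (c • P) (s ×ˢ t) := by
                rw [Measure.smul_apply, hP, Measure.prod_prod]; rfl
            _ = μH[finrank ℝ (V × W)] (s ×ˢ t) := by rw [← hc]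
            _ ≤ ediam (s ×ˢ t) ^ (finrank ℝ (V × W) : ℝ) :=
                hausdorffMeasure_finrank_le_ediam_rpow _
            _ ≤ 1 := ENNReal.rpow_le_one ((ediam_prod_le s t).trans (max_le hs ht))
                (Nat.cast_nonneg _)
        have h2 : (c : ℝ≥0∞) ≤ θ * θ := by
          calc (c : ℝ≥0∞) = c * (1 * 1) := by simp
            _ ≤ c * ((θ * μH[finrank ℝ V] s) * (θ * μH[finrank ℝ W] t)) := by gcongr
            _ = θ * θ * (c * (μH[finrank ℝ V] s * μH[finrank ℝ W] t)) := by ring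
            _ ≤ θ * θ * 1 := by gcongr
            _ = θ * θ := mul_one _
        exact_mod_cast h2
      have htend : Tendsto (fun θ : ℝ≥0 => θ * θ) (𝓝[>] 1) (𝓝 (1 * 1)) :=
        ((continuous_id.mul continuous_id).tendsto (1 : ℝ≥0)).mono_left nhdsWithin_le_nhds
      rw [mul_one] at htend
      exact ge_of_tendsto htend (eventually_mem_nhdsWithin.mono fun θ hθ => h θ hθ)
    rw [hc]
    intro s
    rw [Measure.smul_apply]
    exact mul_le_of_le_one_left zero_le (by exact_mod_cast hcle)
  · refine Measure.le_hausdorffMeasure _ _ 1 one_pos fun s _ => ?_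
    calc P s ≤ P ((Prod.fst '' s) ×ˢ (Prod.snd '' s)) :=
          measure_mono fun x hx => ⟨mem_image_of_mem _ hx, mem_image_of_mem _ hx⟩
      _ = μH[finrank ℝ V] (Prod.fst '' s) * μH[finrank ℝ W] (Prod.snd '' s) := by
          rw [hP, Measure.prod_prod]
      _ ≤ ediam s ^ (finrank ℝ V : ℝ) * ediam s ^ (finrank ℝ W : ℝ) := by
          gcongr
          · exact (hausdorffMeasure_finrank_le_ediam_rpow _).trans
              (ENNReal.rpow_le_rpow (ediam_image_fst_le s) (Nat.cast_nonneg _))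
          · exact (hausdorffMeasure_finrank_le_ediam_rpow _).trans
              (ENNReal.rpow_le_rpow (ediam_image_snd_le s) (Nat.cast_nonneg _))
      _ = ediam s ^ (finrank ℝ (V × W) : ℝ) := by
          rw [hcast, ENNReal.rpow_add_of_nonneg _ _ (Nat.cast_nonneg _) (Nat.cast_nonneg _)]

/-- The Hausdorff measure on `ℝᵏ × ℝˡ` of a product set, for the sup distance. -/
lemma hausdorffMeasure_euclideanSpace_prod (k l : ℕ) (s : Set (EuclideanSpace ℝ (Fin k)))
    (t : Set (EuclideanSpace ℝ (Fin l))) :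
    μH[((k + l : ℕ) : ℝ)] (s ×ˢ t) = μH[(k : ℝ)] s * μH[(l : ℝ)] t := by
  have h := congrArg (fun μ => μ (s ×ˢ t)) (hausdorffMeasure_finrank_prod
    (V := EuclideanSpace ℝ (Fin k)) (W := EuclideanSpace ℝ (Fin l)))
  simp only [Measure.prod_prod, finrank_prod, finrank_euclideanSpace_fin] at h
  exact h

/-- A set of zero `k`-dimensional Hausdorff measure, `0 < k`, admits coverings by small sets with
positive upper bounds on their diameters such that the sum of the `k`-th powers is small. -/
lemma exists_cover_of_hausdorffMeasure_eq_zero {X : Type*} [EMetricSpace X] [MeasurableSpace X]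
    [BorelSpace X] {k : ℕ} (hk : 0 < k) {N : Set X} (hN : μH[(k : ℝ)] N = 0) {ε : ℝ≥0}
    (hε : 0 < ε) :
    ∃ (t : ℕ → Set X) (ρ : ℕ → ℝ≥0), N ⊆ ⋃ i, t i ∧ (∀ i, ediam (t i) ≤ ρ i) ∧
      (∀ i, 0 < ρ i) ∧ (∀ i, ρ i ≤ ε) ∧ ∑' i, (ρ i : ℝ≥0∞) ^ k ≤ ε := by
  have hkr : (0 : ℝ) < k := by exact_mod_cast hk
  have hε2 : 0 < ε / 2 := half_pos hε
  have hε2' : (0 : ℝ≥0∞) < ((ε / 2 : ℝ≥0) : ℝ≥0∞) := by exact_mod_cast hε2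
  rw [Measure.hausdorffMeasure_apply] at hN
  have h1 := (iSup_eq_bot.1 ((iSup_eq_bot.1 hN) ((ε / 2 : ℝ≥0) : ℝ≥0∞)) hε2').trans_lt
    (bot_lt_iff_ne_bot.2 hε2'.ne')
  simp only [iInf_lt_iff] at h1
  obtain ⟨t, hNt, hdiam, hsum⟩ := h1
  obtain ⟨e, he, hesum⟩ := ENNReal.exists_pos_sum_of_countable hε2'.ne' ℕ
  have hsup : ∀ i, (⨆ _ : (t i).Nonempty, ediam (t i) ^ (k : ℝ)) = ediam (t i) ^ k := by
    intro i
    rcases (t i).eq_empty_or_nonempty with h | h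
    · simp [h, hk.ne']
    · simp [h]
  simp only [hsup] at hsum
  have hD : ∀ i, ((ediam (t i)).toNNReal : ℝ≥0∞) = ediam (t i) := fun i =>
    ENNReal.coe_toNNReal ((hdiam i).trans_lt ENNReal.coe_lt_top).ne
  have hex : ∀ i, ∃ x : ℝ≥0, (ediam (t i)).toNNReal < x ∧ x < ε ∧
      x ^ k < (ediam (t i)).toNNReal ^ k + e i := by
    intro i
    set D := (ediam (t i)).toNNReal
    have hDε : D < ε := by
      have : (D : ℝ≥0∞) ≤ ((ε / 2 : ℝ≥0) : ℝ≥0∞) := (hD i).trans_le (hdiam i)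
      exact (ENNReal.coe_le_coe.1 this).trans_lt (half_lt_self hε)
    have ev1 : ∀ᶠ x in 𝓝[>] D, x < ε := nhdsWithin_le_nhds (gt_mem_nhds hDε)
    have ev2 : ∀ᶠ x in 𝓝[>] D, x ^ k < D ^ k + e i := nhdsWithin_le_nhds
      (((continuous_pow k).tendsto D).eventually (gt_mem_nhds (lt_add_of_pos_right _ (he i))))
    obtain ⟨x, hx⟩ := ((eventually_mem_nhdsWithin (a := D) (s := Ioi D)).and (ev1.and ev2)).exists
    exact ⟨x, hx.1, hx.2.1, hx.2.2⟩
  choose ρ h1 h2 h3 using hex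
  refine ⟨t, ρ, hNt, fun i => ?_, fun i => (zero_le).trans_lt (h1 i), fun i => (h2 i).le, ?_⟩
  · rw [← hD i]; exact_mod_cast (h1 i).le
  · calc ∑' i, (ρ i : ℝ≥0∞) ^ k ≤ ∑' i, (ediam (t i) ^ k + e i) := by
          refine ENNReal.tsum_le_tsum fun i => ?_
          rw [← hD i]
          exact_mod_cast (h3 i).le
      _ = ∑' i, ediam (t i) ^ k + ∑' i, (e i : ℝ≥0∞) := ENNReal.tsum_add
      _ ≤ ((ε / 2 : ℝ≥0) : ℝ≥0∞) + ((ε / 2 : ℝ≥0) : ℝ≥0∞) := add_le_add hsum.le hesum.le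
      _ = ε := by rw [← ENNReal.coe_add, add_halves]

/-- The product of a set of zero `k`-dimensional Hausdorff measure and of the unit cube of
dimension `l` has zero `(k + l)`-dimensional Hausdorff measure. -/
lemma hausdorffMeasure_prod_Icc_eq_zero {X : Type*} [EMetricSpace X] [MeasurableSpace X]
    [BorelSpace X] {k : ℕ} (l : ℕ) {N : Set X} (hN : μH[(k : ℝ)] N = 0) :
    μH[((k + l : ℕ) : ℝ)] (N ×ˢ (Icc 0 1 : Set (Fin l → ℝ))) = 0 := by
  rcases Nat.eq_zero_or_pos k with rfl | hk
  · have : N = ∅ := by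
      by_contra hne
      have := Measure.one_le_hausdorffMeasure_zero_of_nonempty (nonempty_iff_ne_empty.2 hne)
      rw [Nat.cast_zero] at hN
      simp [hN] at this
    simp [this]
  have hε : ∀ n : ℕ, (0 : ℝ≥0) < 1 / ((n : ℝ≥0) + 1) := fun n => by positivity
  choose t ρ hcov hdiam hpos hle hsum using
    fun n : ℕ => exists_cover_of_hausdorffMeasure_eq_zero hk hN (hε n)
  let m : ℕ → ℕ → ℕ := fun n i => ⌈(ρ n i)⁻¹⌉₊
  have hm0 : ∀ n i, 0 < m n i := fun n i => Nat.ceil_pos.2 (inv_pos.2 (hpos n i))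
  have hminv : ∀ n i, (m n i : ℝ≥0)⁻¹ ≤ ρ n i := fun n i =>
    inv_le_of_inv_le₀ (hpos n i) (Nat.le_ceil _)
  have hmle : ∀ n i, (m n i : ℝ≥0) * ρ n i ≤ 2 := by
    intro n i
    have h1 : (m n i : ℝ≥0) ≤ (ρ n i)⁻¹ + 1 := (Nat.ceil_lt_add_one zero_le).le
    have h2 : ρ n i ≤ 1 := (hle n i).trans (by
      rw [div_le_one (by positivity)]; exact le_add_of_nonneg_left zero_le)
    calc (m n i : ℝ≥0) * ρ n i ≤ ((ρ n i)⁻¹ + 1) * ρ n i := by gcongr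
      _ = 1 + ρ n i := by rw [add_mul, inv_mul_cancel₀ (hpos n i).ne', one_mul]
      _ ≤ 1 + 1 := by gcongr
      _ = 2 := one_add_one_eq_two
  let Q : (n i : ℕ) → (Fin l → Fin (m n i)) → Set (Fin l → ℝ) := fun n i a =>
    Icc (fun j => ((a j : ℕ) : ℝ) / m n i) (fun j => (((a j : ℕ) : ℝ) + 1) / m n i)
  have hQ : ∀ n i a, ediam (Q n i a) ≤ ρ n i := by
    intro n i a
    refine ediam_le fun x hx y hy => ?_
    refine edist_pi_le_iff.2 fun j => ?_
    refine le_trans ?_ (ENNReal.coe_le_coe.2 (hminv n i))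
    have hmr : (0 : ℝ) < m n i := by exact_mod_cast hm0 n i
    have hx1 := hx.1 j
    have hx2 := hx.2 j
    have hy1 := hy.1 j
    have hy2 := hy.2 j
    simp only [add_div] at hx1 hx2 hy1 hy2
    rw [edist_dist, ENNReal.ofReal_le_iff_le_toReal ENNReal.coe_ne_top, Real.dist_eq]
    simp only [ENNReal.coe_toReal, NNReal.coe_inv, NNReal.coe_natCast]
    rw [abs_le, ← one_div]
    constructor <;> linarith
  have hmain : ∀ n : ℕ, ∑' p : (Σ i : ℕ, (Fin l → Fin (m n i))),
      ediam (t n p.1 ×ˢ Q n p.1 p.2) ^ ((k + l : ℕ) : ℝ) ≤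
        2 ^ l * ((1 / ((n : ℝ≥0) + 1) : ℝ≥0) : ℝ≥0∞) := by
    intro n
    calc ∑' p : (Σ i : ℕ, (Fin l → Fin (m n i))),
          ediam (t n p.1 ×ˢ Q n p.1 p.2) ^ ((k + l : ℕ) : ℝ)
        ≤ ∑' p : (Σ i : ℕ, (Fin l → Fin (m n i))), (ρ n p.1 : ℝ≥0∞) ^ (k + l) := by
          refine ENNReal.tsum_le_tsum fun p => ?_
          rw [ENNReal.rpow_natCast]
          gcongr
          exact (ediam_prod_le _ _).trans (max_le (hdiam n p.1) (hQ n p.1 p.2))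
      _ = ∑' i, ((m n i : ℝ≥0∞) * ρ n i) ^ l * (ρ n i : ℝ≥0∞) ^ k := by
          rw [ENNReal.tsum_sigma (fun i (_ : Fin l → Fin (m n i)) => (ρ n i : ℝ≥0∞) ^ (k + l))]
          refine tsum_congr fun i => ?_
          rw [tsum_fintype, Finset.sum_const, Finset.card_univ, Fintype.card_fun, Fintype.card_fin,
            Fintype.card_fin, nsmul_eq_mul]
          push_cast
          ring
      _ ≤ ∑' i, 2 ^ l * (ρ n i : ℝ≥0∞) ^ k := by
          refine ENNReal.tsum_le_tsum fun i => ?_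
          have : (m n i : ℝ≥0∞) * ρ n i ≤ 2 := by exact_mod_cast hmle n i
          gcongr
      _ ≤ _ := by
          rw [ENNReal.tsum_mul_left]
          gcongr
          exact hsum n
  have htend : Tendsto (fun n : ℕ => ((1 / ((n : ℝ≥0) + 1) : ℝ≥0) : ℝ≥0∞)) atTop (𝓝 0) := by
    rw [← ENNReal.coe_zero]
    exact ENNReal.tendsto_coe.2 tendsto_one_div_add_atTop_nhds_zero_nat
  rw [← nonpos_iff_eq_zero]
  calc μH[((k + l : ℕ) : ℝ)] (N ×ˢ (Icc 0 1 : Set (Fin l → ℝ)))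
      ≤ liminf (fun n => ∑' p : (Σ i : ℕ, (Fin l → Fin (m n i))),
          ediam (t n p.1 ×ˢ Q n p.1 p.2) ^ ((k + l : ℕ) : ℝ)) atTop := by
        refine Measure.hausdorffMeasure_le_liminf_tsum _ _ _ htend
          (fun n (p : Σ i : ℕ, (Fin l → Fin (m n i))) => t n p.1 ×ˢ Q n p.1 p.2)
          (Eventually.of_forall fun n p => ?_) (Eventually.of_forall fun n => ?_)
        · exact (ediam_prod_le _ _).trans (max_le ((hdiam n p.1).trans
            (ENNReal.coe_le_coe.2 (hle n p.1))) ((hQ n p.1 p.2).trans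
              (ENNReal.coe_le_coe.2 (hle n p.1))))
        · rintro ⟨x, y⟩ ⟨hx, hy⟩
          obtain ⟨i, hi⟩ := mem_iUnion.1 (hcov n hx)
          have hmr : (0 : ℝ) < m n i := by exact_mod_cast hm0 n i
          have hy0 : ∀ j, 0 ≤ y j := hy.1
          have hy1 : ∀ j, y j ≤ 1 := hy.2
          have hex : ∀ j, ∃ a : Fin (m n i), ((a : ℕ) : ℝ) / m n i ≤ y j ∧
              y j ≤ (((a : ℕ) : ℝ) + 1) / m n i := by
            intro j
            simp only [div_le_iff₀ hmr, le_div_iff₀ hmr]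
            rcases (hy1 j).lt_or_eq with hlt | heq
            · have hyn : 0 ≤ y j * m n i := mul_nonneg (hy0 j) hmr.le
              refine ⟨⟨⌊y j * m n i⌋₊, ?_⟩, Nat.floor_le hyn, (Nat.lt_floor_add_one _).le⟩
              rw [Nat.floor_lt hyn]
              exact mul_lt_of_lt_one_left hmr hlt
            · refine ⟨⟨m n i - 1, Nat.sub_lt (hm0 n i) one_pos⟩, ?_⟩
              simp only [heq, one_mul]
              rw [Nat.cast_pred (hm0 n i)]
              constructor <;> simp
          choose a ha1 ha2 using hex
          exact mem_iUnion.2 ⟨⟨i, a⟩, hi, ha1, ha2⟩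
    _ ≤ liminf (fun n : ℕ => 2 ^ l * ((1 / ((n : ℝ≥0) + 1) : ℝ≥0) : ℝ≥0∞)) atTop :=
        liminf_le_liminf (Eventually.of_forall hmain)
    _ = 0 := by
        have := ENNReal.Tendsto.const_mul (a := (2 : ℝ≥0∞) ^ l) htend (Or.inr (by simp))
        rw [mul_zero] at this
        exact this.liminf_eq

/-- The product of a set of zero `k`-dimensional Hausdorff measure and of a set covered by a
Lipschitz image of `ℝˡ` has zero `(k + l)`-dimensional Hausdorff measure. -/
lemma hausdorffMeasure_prod_range_eq_zero {X Y : Type*} [EMetricSpace X] [MeasurableSpace X]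
    [BorelSpace X] [EMetricSpace Y] [MeasurableSpace Y] [BorelSpace Y]
    [SecondCountableTopology Y] {k l : ℕ} {N : Set X} (hN : μH[(k : ℝ)] N = 0)
    {f : EuclideanSpace ℝ (Fin l) → Y} {K : ℝ≥0} (hf : LipschitzWith K f) :
    μH[((k + l : ℕ) : ℝ)] (N ×ˢ range f) = 0 := by
  have hcube : ∀ v : Fin l → ℤ, ∃ (h : (Fin l → ℝ) → Y) (K' : ℝ≥0), LipschitzWith K' h ∧
      ∀ x : EuclideanSpace ℝ (Fin l), (∀ j, ⌊x j⌋ = v j) → f x ∈ h '' Icc 0 1 := by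
    intro v
    let w : Fin l → ℝ := fun j => v j
    refine ⟨fun y => f (WithLp.toLp 2 (w + y)), _,
      (hf.comp (PiLp.lipschitzWith_toLp 2 (fun _ : Fin l => ℝ))).comp
        (isometry_add_left w).lipschitz, fun x hx => ?_⟩
    refine ⟨fun j => Int.fract (x j), ⟨fun j => Int.fract_nonneg _, fun j =>
      (Int.fract_lt_one _).le⟩, ?_⟩
    refine congrArg f (PiLp.ext fun j => ?_)
    simp [w, ← hx j, Int.floor_add_fract]
  choose h K' hlip hmem using hcube
  have hsub : N ×ˢ range f ⊆ ⋃ v : Fin l → ℤ, Prod.map id (h v) '' (N ×ˢ Icc 0 1) := by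
    rintro ⟨x, _⟩ ⟨hx, y, rfl⟩
    obtain ⟨z, hz, hzy⟩ := hmem (fun j => ⌊y j⌋) y fun _ => rfl
    exact mem_iUnion.2 ⟨_, (x, z), ⟨hx, hz⟩, Prod.ext rfl hzy⟩
  refine measure_mono_null hsub (measure_iUnion_null fun v => ?_)
  have hmap : LipschitzWith (max 1 (K' v)) (Prod.map (id : X → X) (h v)) := by
    have := (LipschitzWith.id.comp LipschitzWith.prod_fst).prodMk
      ((hlip v).comp (LipschitzWith.prod_snd (α := X)))
    rwa [mul_one, mul_one] at this
  have := hmap.hausdorffMeasure_image_le (d := ((k + l : ℕ) : ℝ)) (Nat.cast_nonneg _)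
    (N ×ˢ (Icc 0 1 : Set (Fin l → ℝ)))
  rw [hausdorffMeasure_prod_Icc_eq_zero l hN, mul_zero] at this
  exact nonpos_iff_eq_zero.1 this

/-- A set `E` is `c`-almost Euclidean of dimension `k` if it is parametrized by a subset of `ℝᵏ`
through a bijection which is `c`-Lipschitz together with its inverse. -/
def IsAlmostEuclidean (c : ℝ≥0) (k : ℕ) {X : Type*} [PseudoEMetricSpace X] (E : Set X) : Prop :=
  ∃ (φ : EuclideanSpace ℝ (Fin k) → X) (ψ : X → EuclideanSpace ℝ (Fin k)),
    LipschitzOnWith c ψ E ∧ LipschitzOnWith c φ (ψ '' E) ∧ ∀ x ∈ E, φ (ψ x) = x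

lemma isAddHaarMeasure_hausdorffMeasure_euclideanSpace (k : ℕ) :
    (μH[(k : ℝ)] : Measure (EuclideanSpace ℝ (Fin k))).IsAddHaarMeasure := by
  have h := isAddHaarMeasure_hausdorffMeasure (E := EuclideanSpace ℝ (Fin k))
  rwa [finrank_euclideanSpace_fin] at h

/-- The image of a set on which a map is approximated by a non-injective linear map has small
Hausdorff measure. -/
lemma hausdorffMeasure_image_le_of_approximatesLinearOn_not_injective {k : ℕ} {F : Type*}
    [NormedAddCommGroup F] [NormedSpace ℝ F] [MeasurableSpace F] [BorelSpace F]
    {f : EuclideanSpace ℝ (Fin k) → F} {A : EuclideanSpace ℝ (Fin k) →L[ℝ] F}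
    {s : Set (EuclideanSpace ℝ (Fin k))} {δ K : ℝ≥0} (hδ : 0 < δ) (hδ1 : δ ≤ 1) (hA : ‖A‖ ≤ K)
    (hinj : ¬ Function.Injective A) (hf : ApproximatesLinearOn f A s δ) :
    μH[(k : ℝ)] (f '' s) ≤ ((2 * K + 3 : ℝ≥0) : ℝ≥0∞) ^ (k : ℝ) * (δ * μH[(k : ℝ)] s) := by
  have hHaar := isAddHaarMeasure_hausdorffMeasure_euclideanSpace k
  have hδr : (0 : ℝ) < δ := hδ
  have hδ1r : (δ : ℝ) ≤ 1 := hδ1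
  obtain ⟨e₀, he₀, hne⟩ : ∃ e, A e = 0 ∧ e ≠ 0 := by
    rw [injective_iff_map_eq_zero] at hinj
    push Not at hinj
    exact hinj
  set e := (‖e₀‖)⁻¹ • e₀ with he
  have hAe : A e = 0 := by rw [he, map_smul, he₀, smul_zero]
  have hnorm : ‖e‖ = 1 := norm_smul_inv_norm (𝕜 := ℝ) hne
  set M : EuclideanSpace ℝ (Fin k) →ₗ[ℝ] EuclideanSpace ℝ (Fin k) :=
    LinearMap.transvection ((-(1 - (δ : ℝ))) • (innerSL ℝ e).toLinearMap) e with hM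
  have hinner : inner ℝ e e = (1 : ℝ) := by rw [real_inner_self_eq_norm_sq, hnorm, one_pow]
  have hMapply : ∀ z, M z = z - ((1 - (δ : ℝ)) * inner ℝ e z) • e := by
    intro z
    rw [hM, LinearMap.transvection.apply]
    simp [sub_eq_add_neg]
    module
  have hdet : LinearMap.det M = δ := by
    rw [hM, LinearMap.transvection.det]
    simp [hnorm]
  have ha : ∀ z, δ * |inner ℝ e z| ≤ ‖M z‖ := by
    intro z
    have h1 : inner ℝ e (M z) = δ * inner ℝ e z := by
      rw [hMapply, inner_sub_right, inner_smul_right, hinner]; ring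
    have h2 := abs_real_inner_le_norm e (M z)
    rw [h1, abs_mul, abs_of_pos hδr, hnorm, one_mul] at h2
    exact h2
  have hb : ∀ z, ‖z - (inner ℝ e z : ℝ) • e‖ ≤ 2 * ‖M z‖ := by
    intro z
    have h1 : z - (inner ℝ e z : ℝ) • e = M z - (δ * inner ℝ e z : ℝ) • e := by
      rw [hMapply]; module
    calc ‖z - (inner ℝ e z : ℝ) • e‖ ≤ ‖M z‖ + ‖(δ * inner ℝ e z : ℝ) • e‖ := by
          rw [h1]; exact norm_sub_le _ _
      _ = ‖M z‖ + δ * |inner ℝ e z| := by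
          rw [norm_smul, hnorm, mul_one, Real.norm_eq_abs, abs_mul, abs_of_pos hδr]
      _ ≤ 2 * ‖M z‖ := by linarith [ha z]
  have hz : ∀ z, ‖A z‖ + δ * ‖z‖ ≤ (2 * K + 3) * ‖M z‖ := by
    intro z
    have h1 : A z = A (z - (inner ℝ e z : ℝ) • e) := by
      rw [map_sub, map_smul, hAe, smul_zero, sub_zero]
    have h2 : ‖A z‖ ≤ K * (2 * ‖M z‖) := by
      rw [h1]
      exact (A.le_of_opNorm_le hA _).trans (by gcongr; exact hb z)
    have h3 : ‖z‖ ≤ 2 * ‖M z‖ + |inner ℝ e z| := by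
      calc ‖z‖ = ‖(z - (inner ℝ e z : ℝ) • e) + (inner ℝ e z : ℝ) • e‖ := by
            rw [sub_add_cancel]
        _ ≤ ‖z - (inner ℝ e z : ℝ) • e‖ + ‖(inner ℝ e z : ℝ) • e‖ := norm_add_le _ _
        _ ≤ _ := by
            rw [norm_smul, hnorm, mul_one, Real.norm_eq_abs]
            gcongr
            exact hb z
    have h4 : δ * ‖z‖ ≤ 2 * ‖M z‖ + ‖M z‖ := by
      calc δ * ‖z‖ ≤ δ * (2 * ‖M z‖ + |inner ℝ e z|) := by gcongr
        _ = δ * (2 * ‖M z‖) + δ * |inner ℝ e z| := mul_add _ _ _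
        _ ≤ 1 * (2 * ‖M z‖) + ‖M z‖ := by gcongr; exact ha z
        _ = _ := by ring
    linarith
  have hMinj : Function.Injective M := by
    have hu : IsUnit (LinearMap.det M) := by rw [hdet]; exact hδr.ne'.isUnit
    exact ((Module.End.isUnit_iff M).1 ((LinearMap.isUnit_iff_isUnit_det M).2 hu)).1
  set g := Function.invFun M
  have hgM : ∀ x, g (M x) = x := Function.leftInverse_invFun hMinj
  have himg : f '' s = (f ∘ g) '' (M '' s) := by
    rw [image_image]
    exact image_congr fun x _ => by simp [hgM]
  have hLip : LipschitzOnWith (2 * K + 3) (f ∘ g) (M '' s) := by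
    refine LipschitzOnWith.of_dist_le_mul ?_
    rintro _ ⟨x, hx, rfl⟩ _ ⟨y, hy, rfl⟩
    simp only [Function.comp, hgM]
    rw [dist_eq_norm, dist_eq_norm, ← map_sub]
    calc ‖f x - f y‖ = ‖A (x - y) + (f x - f y - A (x - y))‖ := by rw [add_sub_cancel]
      _ ≤ ‖A (x - y)‖ + ‖f x - f y - A (x - y)‖ := norm_add_le _ _
      _ ≤ ‖A (x - y)‖ + δ * ‖x - y‖ := by gcongr; exact hf x hx y hy
      _ ≤ (2 * K + 3) * ‖M (x - y)‖ := hz _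
  rw [himg]
  refine (hLip.hausdorffMeasure_image_le (Nat.cast_nonneg k)).trans ?_
  rw [Measure.addHaar_image_linearMap, hdet, abs_of_pos hδr, ENNReal.ofReal_coe_nnreal]

/-- The image under a Lipschitz map `ℝᵏ → F` of the set of points where the derivative is not
injective is negligible for the `k`-dimensional Hausdorff measure. -/
lemma hausdorffMeasure_image_not_injective_fderiv_eq_zero {k : ℕ} {F : Type*}
    [NormedAddCommGroup F] [NormedSpace ℝ F] [FiniteDimensional ℝ F] [MeasurableSpace F]
    [BorelSpace F] {f : EuclideanSpace ℝ (Fin k) → F} {K : ℝ≥0} (hf : LipschitzWith K f) :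
    μH[(k : ℝ)] (f '' {x | DifferentiableAt ℝ f x ∧ ¬ Function.Injective (fderiv ℝ f x)}) = 0 := by
  have hHaar := isAddHaarMeasure_hausdorffMeasure_euclideanSpace k
  set C := {x | DifferentiableAt ℝ f x ∧ ¬ Function.Injective (fderiv ℝ f x)} with hC
  have hCmeas : MeasurableSet C := (measurableSet_of_differentiableAt ℝ f).inter
    ((measurable_fderiv ℝ f) ContinuousLinearMap.isOpen_injective.measurableSet.compl)
  have hcov : f '' C ⊆ ⋃ n : ℕ, f '' (C ∩ ball 0 n) := by
    rw [← image_iUnion, ← inter_iUnion, iUnion_ball_nat, inter_univ]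
  refine measure_mono_null hcov (measure_iUnion_null fun R => ?_)
  set s := C ∩ ball 0 (R : ℝ) with hs
  have hsmeas : MeasurableSet s := hCmeas.inter measurableSet_ball
  have hsfin : μH[(k : ℝ)] s ≠ ∞ :=
    ((measure_mono inter_subset_right).trans_lt measure_ball_lt_top).ne
  rcases s.eq_empty_or_nonempty with he | hne
  · simp [he]
  have hbound : ∀ δ : ℝ≥0, 0 < δ → δ ≤ 1 →
      μH[(k : ℝ)] (f '' s) ≤ ((2 * K + 3 : ℝ≥0) : ℝ≥0∞) ^ (k : ℝ) * (δ * μH[(k : ℝ)] s) := by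
    intro δ hδ hδ1
    obtain ⟨t, A, hdisj, htm, hst, happ, hA⟩ :=
      exists_partition_approximatesLinearOn_of_hasFDerivWithinAt f s (fderiv ℝ f)
        (fun x hx => hx.1.1.hasFDerivAt.hasFDerivWithinAt) (fun _ => δ) (fun _ => hδ.ne')
    calc μH[(k : ℝ)] (f '' s) ≤ μH[(k : ℝ)] (⋃ n, f '' (s ∩ t n)) := by
          rw [← image_iUnion, ← inter_iUnion]
          exact measure_mono (image_mono (subset_inter Subset.rfl hst))
      _ ≤ ∑' n, μH[(k : ℝ)] (f '' (s ∩ t n)) := measure_iUnion_le _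
      _ ≤ ∑' n, ((2 * K + 3 : ℝ≥0) : ℝ≥0∞) ^ (k : ℝ) * (δ * μH[(k : ℝ)] (s ∩ t n)) := by
          refine ENNReal.tsum_le_tsum fun n => ?_
          obtain ⟨y, hy, hAy⟩ := hA hne n
          refine hausdorffMeasure_image_le_of_approximatesLinearOn_not_injective hδ hδ1 ?_ ?_
            (happ n)
          · rw [hAy]; exact norm_fderiv_le_of_lipschitz ℝ hf
          · rw [hAy]; exact hy.1.2
      _ = _ := by
          rw [ENNReal.tsum_mul_left, ENNReal.tsum_mul_left, ← measure_iUnion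
            (fun i j hij => (hdisj hij).mono inter_subset_right inter_subset_right)
            (fun n => hsmeas.inter (htm n)), ← inter_iUnion, inter_eq_left.2 hst]
  set c := ((2 * K + 3 : ℝ≥0) : ℝ≥0∞) ^ (k : ℝ) with hc
  have hcfin : c ≠ ∞ := by
    rw [hc, ENNReal.rpow_natCast]
    exact ENNReal.pow_ne_top ENNReal.coe_ne_top
  have htend : Tendsto (fun δ : ℝ≥0 => c * (δ * μH[(k : ℝ)] s)) (𝓝[>] 0)
      (𝓝 (c * (((0 : ℝ≥0) : ℝ≥0∞) * μH[(k : ℝ)] s))) := by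
    refine ENNReal.Tendsto.const_mul (ENNReal.Tendsto.mul_const ?_ (Or.inr hsfin)) (Or.inr hcfin)
    exact ENNReal.tendsto_coe.2 nhdsWithin_le_nhds
  rw [ENNReal.coe_zero, zero_mul, mul_zero] at htend
  rw [← nonpos_iff_eq_zero]
  refine ge_of_tendsto htend ?_
  filter_upwards [eventually_mem_nhdsWithin (a := (0 : ℝ≥0)) (s := Ioi 0),
    nhdsWithin_le_nhds (gt_mem_nhds (one_pos : (0 : ℝ≥0) < 1))] with δ h0 h1
  exact hbound δ h0 (le_of_lt h1)

/-- A linear injection from `ℝᵏ` to a Euclidean space has the same norm as some linear automorphism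
of `ℝᵏ`. -/
lemma exists_linearEquiv_norm_eq {k : ℕ} {F : Type*} [NormedAddCommGroup F]
    [InnerProductSpace ℝ F] {A : EuclideanSpace ℝ (Fin k) →L[ℝ] F} (hA : Function.Injective A) :
    ∃ h : EuclideanSpace ℝ (Fin k) ≃ₗ[ℝ] EuclideanSpace ℝ (Fin k), ∀ z, ‖h z‖ = ‖A z‖ := by
  have hfin : finrank ℝ (LinearMap.range A.toLinearMap) = k := by
    rw [LinearMap.finrank_range_of_inj hA, finrank_euclideanSpace_fin]
  let b := (stdOrthonormalBasis ℝ (LinearMap.range A.toLinearMap)).reindex (finCongr hfin)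
  refine ⟨(LinearEquiv.ofInjective A.toLinearMap hA).trans b.repr.toLinearEquiv, fun z => ?_⟩
  change ‖b.repr (LinearEquiv.ofInjective A.toLinearMap hA z)‖ = _
  rw [LinearIsometryEquiv.norm_map]
  rfl

/-- The image of a set on which a map is well approximated by an injective linear map is almost
Euclidean. -/
lemma isAlmostEuclidean_image {k : ℕ} {F : Type*} [NormedAddCommGroup F] [InnerProductSpace ℝ F]
    {f : EuclideanSpace ℝ (Fin k) → F} {A : EuclideanSpace ℝ (Fin k) →L[ℝ] F}
    {s : Set (EuclideanSpace ℝ (Fin k))} {c : ℝ≥0} {ε : ℝ} (hA : Function.Injective A)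
    (h1 : 1 + ε ≤ c) (h2 : 1 ≤ c * (1 - ε))
    (hf : ∀ x ∈ s, ∀ y ∈ s, ‖f x - f y - A (x - y)‖ ≤ ε * ‖A (x - y)‖) :
    IsAlmostEuclidean c k (f '' s) := by
  obtain ⟨h, hh⟩ := exists_linearEquiv_norm_eq hA
  set g := Function.invFunOn f s
  have hg : ∀ p ∈ f '' s, g p ∈ s ∧ f (g p) = p := fun p hp =>
    ⟨Function.invFunOn_mem hp, Function.invFunOn_eq hp⟩
  refine ⟨f ∘ h.symm, h ∘ g, ?_, ?_, fun p hp => by simp [(hg p hp).2]⟩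
  · refine LipschitzOnWith.of_dist_le_mul fun p hp q hq => ?_
    have happ := hf _ (hg p hp).1 _ (hg q hq).1
    rw [(hg p hp).2, (hg q hq).2] at happ
    simp only [Function.comp]
    rw [dist_eq_norm, dist_eq_norm, ← map_sub, hh]
    have h3 : ‖A (g p - g q)‖ ≤ ‖p - q‖ + ‖p - q - A (g p - g q)‖ := by
      rw [← norm_neg (p - q - A (g p - g q))]
      refine le_trans (le_of_eq ?_) (norm_add_le _ _)
      congr 1; abel
    have h4 : (1 - ε) * ‖A (g p - g q)‖ ≤ ‖p - q‖ := by linarith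
    calc ‖A (g p - g q)‖ ≤ (c * (1 - ε)) * ‖A (g p - g q)‖ :=
          le_mul_of_one_le_left (norm_nonneg _) h2
      _ = c * ((1 - ε) * ‖A (g p - g q)‖) := mul_assoc _ _ _
      _ ≤ c * ‖p - q‖ := by gcongr
  · refine LipschitzOnWith.of_dist_le_mul ?_
    rintro _ ⟨p, hp, rfl⟩ _ ⟨q, hq, rfl⟩
    have happ := hf _ (hg p hp).1 _ (hg q hq).1
    simp only [Function.comp, LinearEquiv.symm_apply_apply]
    rw [dist_eq_norm, dist_eq_norm, ← map_sub, hh]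
    set x := g p
    set y := g q
    calc ‖f x - f y‖ = ‖A (x - y) + (f x - f y - A (x - y))‖ := by rw [add_sub_cancel]
      _ ≤ ‖A (x - y)‖ + ‖f x - f y - A (x - y)‖ := norm_add_le _ _
      _ ≤ (1 + ε) * ‖A (x - y)‖ := by linarith
      _ ≤ c * ‖A (x - y)‖ := by gcongr

/-- Up to a negligible set, a Lipschitz image of `ℝᵏ` in a Euclidean space is a countable union of
measurable almost Euclidean sets. -/
lemma exists_isAlmostEuclidean_cover_range {k : ℕ} {F : Type*} [NormedAddCommGroup F]
    [InnerProductSpace ℝ F] [FiniteDimensional ℝ F] [MeasurableSpace F] [BorelSpace F]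
    {f : EuclideanSpace ℝ (Fin k) → F} {K : ℝ≥0} (hf : LipschitzWith K f) {c : ℝ≥0} (hc : 1 < c) :
    ∃ E : ℕ → Set F, (∀ i, MeasurableSet (E i)) ∧ (∀ i, IsAlmostEuclidean c k (E i)) ∧
      (∀ i, E i ⊆ range f) ∧ μH[(k : ℝ)] (range f \ ⋃ i, E i) = 0 := by
  have hHaar := isAddHaarMeasure_hausdorffMeasure_euclideanSpace k
  set I := {x | DifferentiableAt ℝ f x ∧ Function.Injective (fderiv ℝ f x)} with hI
  have hImeas : MeasurableSet I := (measurableSet_of_differentiableAt ℝ f).inter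
    ((measurable_fderiv ℝ f) ContinuousLinearMap.isOpen_injective.measurableSet)
  have hcr : (1 : ℝ) < c := hc
  set ε : ℝ≥0 := 1 - c⁻¹ with hε
  have hcinv : c⁻¹ < 1 := inv_lt_one_of_one_lt₀ hc
  have hε0 : 0 < ε := tsub_pos_of_lt hcinv
  have hεr : (ε : ℝ) = 1 - (c : ℝ)⁻¹ := by rw [hε, NNReal.coe_sub hcinv.le]; simp
  have hmul : (c : ℝ) * (c : ℝ)⁻¹ = 1 := mul_inv_cancel₀ (by positivity)
  have h1 : 1 + (ε : ℝ) ≤ c := by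
    rw [hεr]
    have hci : (c : ℝ)⁻¹ < 1 := inv_lt_one_of_one_lt₀ hcr
    nlinarith [mul_pos (sub_pos.2 hcr) (sub_pos.2 hci)]
  have h2 : 1 ≤ (c : ℝ) * (1 - ε) := by rw [hεr]; linarith
  have hε1 : (ε : ℝ) < 1 := by rw [hεr]; linarith [show (0 : ℝ) < (c : ℝ)⁻¹ by positivity]
  have hex : ∀ A : EuclideanSpace ℝ (Fin k) →L[ℝ] F, ∃ r : ℝ≥0, r ≠ 0 ∧
      (Function.Injective A → ∀ z, r * ‖z‖ ≤ ε * ‖A z‖) := by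
    intro A
    by_cases hA : Function.Injective A
    · obtain ⟨κ, hκ, hanti⟩ := A.injective_iff_antilipschitz.1 hA
      refine ⟨ε / κ, (div_pos hε0 hκ).ne', fun _ z => ?_⟩
      have := hanti.le_mul_dist z 0
      rw [map_zero, dist_zero_right, dist_zero_right] at this
      have hκr : (0 : ℝ) < κ := hκ
      rw [NNReal.coe_div, div_mul_eq_mul_div, div_le_iff₀ hκr, mul_assoc, mul_comm ‖A z‖]
      gcongr
      exact this
    · exact ⟨1, one_ne_zero, fun h => absurd h hA⟩
  choose r hr0 hr using hex
  obtain ⟨t, A, -, htm, hIt, happ, hA⟩ :=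
    exists_partition_approximatesLinearOn_of_hasFDerivWithinAt f I (fderiv ℝ f)
      (fun x hx => hx.1.hasFDerivAt.hasFDerivWithinAt) r hr0
  have happ' : ∀ n, ∀ x ∈ I ∩ t n, Function.Injective (A n) ∧ ∀ y ∈ I ∩ t n,
      ‖f x - f y - A n (x - y)‖ ≤ ε * ‖A n (x - y)‖ := by
    intro n x hx
    obtain ⟨z, hz, hAz⟩ := hA ⟨x, hx.1⟩ n
    have hinj : Function.Injective (A n) := by rw [hAz]; exact hz.2
    exact ⟨hinj, fun y hy => (happ n x hx y hy).trans (hr _ hinj _)⟩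
  refine ⟨fun n => f '' (I ∩ t n), fun n => ?_, fun n => ?_, fun n => image_subset_range _ _, ?_⟩
  · refine (hImeas.inter (htm n)).image_of_continuousOn_injOn hf.continuous.continuousOn ?_
    intro x hx y hy hxy
    obtain ⟨hinj, h⟩ := happ' n x hx
    have h3 := h y hy
    rw [hxy, sub_self, zero_sub, norm_neg] at h3
    have h4 : ‖A n (x - y)‖ = 0 := by nlinarith [norm_nonneg (A n (x - y))]
    rw [norm_eq_zero, ← map_zero (A n)] at h4
    exact sub_eq_zero.1 (hinj h4)
  · rcases (I ∩ t n).eq_empty_or_nonempty with he | ⟨x, hx⟩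
    · change IsAlmostEuclidean c k (f '' (I ∩ t n))
      rw [he, image_empty]
      exact ⟨fun _ => 0, fun _ => 0, by simp, by simp, by simp⟩
    · exact isAlmostEuclidean_image (happ' n x hx).1 h1 h2 fun x hx => (happ' n x hx).2
  · have hsub : range f \ ⋃ n, f '' (I ∩ t n) ⊆
        f '' {x | ¬ DifferentiableAt ℝ f x} ∪
          f '' {x | DifferentiableAt ℝ f x ∧ ¬ Function.Injective (fderiv ℝ f x)} := by
      rintro _ ⟨⟨x, rfl⟩, hx⟩
      by_cases hd : DifferentiableAt ℝ f x
      · by_cases hi : Function.Injective (fderiv ℝ f x)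
        · obtain ⟨n, hn⟩ := mem_iUnion.1 (hIt (show x ∈ I from ⟨hd, hi⟩))
          exact absurd (mem_iUnion.2
            ⟨n, mem_image_of_mem f (show x ∈ I ∩ t n from ⟨⟨hd, hi⟩, hn⟩)⟩) hx
        · exact Or.inr (mem_image_of_mem f ⟨hd, hi⟩)
      · exact Or.inl (mem_image_of_mem f hd)
    refine measure_mono_null hsub (measure_union_null ?_
      (hausdorffMeasure_image_not_injective_fderiv_eq_zero hf))
    have hnull : μH[(k : ℝ)] {x | ¬ DifferentiableAt ℝ f x} = 0 :=
      ae_iff.1 (hf.ae_differentiableAt (μ := μH[(k : ℝ)]))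
    have := hf.hausdorffMeasure_image_le (d := (k : ℝ)) (Nat.cast_nonneg _)
      {x | ¬ DifferentiableAt ℝ f x}
    rw [hnull, mul_zero] at this
    exact nonpos_iff_eq_zero.1 this

lemma IsRectifiable.exists_subset_range {k : ℕ} {X : Type*} [PseudoEMetricSpace X] {S : Set X}
    (hS : IsRectifiable k S) :
    ∃ (f : EuclideanSpace ℝ (Fin k) → X) (K : ℝ≥0), LipschitzWith K f ∧ S ⊆ range f := by
  obtain ⟨f, K, A, hf, hSA⟩ := hS
  exact ⟨f, K, hf, hSA.trans (image_subset_range f A)⟩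

lemma IsRectifiable.hausdorffMeasure_prod_eq_zero_left {X Y : Type*} [EMetricSpace X]
    [MeasurableSpace X] [BorelSpace X] [EMetricSpace Y] [MeasurableSpace Y] [BorelSpace Y]
    [SecondCountableTopology Y] {k l : ℕ} {N : Set X} {S : Set Y} (hS : IsRectifiable l S)
    (hN : μH[(k : ℝ)] N = 0) : μH[((k + l : ℕ) : ℝ)] (N ×ˢ S) = 0 := by
  obtain ⟨f, K, hf, hSf⟩ := hS.exists_subset_range
  exact measure_mono_null (prod_mono_right hSf) (hausdorffMeasure_prod_range_eq_zero hN hf)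

lemma IsRectifiable.hausdorffMeasure_prod_eq_zero_right {X Y : Type*} [EMetricSpace X]
    [MeasurableSpace X] [BorelSpace X] [EMetricSpace Y] [MeasurableSpace Y] [BorelSpace Y]
    [SecondCountableTopology X] {k l : ℕ} {S : Set X} {N : Set Y} (hS : IsRectifiable k S)
    (hN : μH[(l : ℝ)] N = 0) : μH[((k + l : ℕ) : ℝ)] (S ×ˢ N) = 0 := by
  have hswap : LipschitzWith 1 (Prod.swap : Y × X → X × Y) := fun p q => by
    rw [Prod.edist_eq, Prod.edist_eq, ENNReal.coe_one, one_mul, max_comm]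
    rfl
  have h := hswap.hausdorffMeasure_image_le (d := ((l + k : ℕ) : ℝ)) (Nat.cast_nonneg _) (N ×ˢ S)
  rw [image_swap_prod, hS.hausdorffMeasure_prod_eq_zero_left hN, mul_zero, nonpos_iff_eq_zero,
    add_comm l k] at h
  exact h

lemma IsAlmostEuclidean.mono {c : ℝ≥0} {k : ℕ} {X : Type*} [PseudoEMetricSpace X] {A E : Set X}
    (hE : IsAlmostEuclidean c k E) (hAE : A ⊆ E) : IsAlmostEuclidean c k A := by
  obtain ⟨φ, ψ, hψ, hφ, h⟩ := hE
  exact ⟨φ, ψ, hψ.mono hAE, hφ.mono (image_mono hAE), fun x hx => h x (hAE hx)⟩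

lemma lipschitzOnWith_prodMap {X Y X' Y' : Type*} [PseudoEMetricSpace X] [PseudoEMetricSpace Y]
    [PseudoEMetricSpace X'] [PseudoEMetricSpace Y'] {c : ℝ≥0} {f : X → X'} {g : Y → Y'}
    {s : Set X} {t : Set Y} (hf : LipschitzOnWith c f s) (hg : LipschitzOnWith c g t) :
    LipschitzOnWith c (Prod.map f g) (s ×ˢ t) := by
  intro p hp q hq
  refine max_le ?_ ?_
  · exact (hf hp.1 hq.1).trans (by gcongr; exact le_max_left _ _)
  · exact (hg hp.2 hq.2).trans (by gcongr; exact le_max_right _ _)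

lemma IsAlmostEuclidean.hausdorffMeasure_prod_le {X Y : Type*} [EMetricSpace X]
    [MeasurableSpace X] [BorelSpace X] [EMetricSpace Y] [MeasurableSpace Y] [BorelSpace Y]
    [BorelSpace (X × Y)]
    {k l : ℕ} {c : ℝ≥0} {A : Set X} {B : Set Y}
    (hA : IsAlmostEuclidean c k A) (hB : IsAlmostEuclidean c l B) :
    μH[((k + l : ℕ) : ℝ)] (A ×ˢ B) ≤
      (c : ℝ≥0∞) ^ (2 * (k + l)) * (μH[(k : ℝ)] A * μH[(l : ℝ)] B) := by
  obtain ⟨φ, ψ, hψ, hφ, h⟩ := hA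
  obtain ⟨φ₂, ψ₂, hψ₂, hφ₂, h'⟩ := hB
  have h1 := (lipschitzOnWith_prodMap hφ hφ₂).hausdorffMeasure_image_le
    (d := ((k + l : ℕ) : ℝ)) (Nat.cast_nonneg _)
  rw [prodMap_image_prod, LeftInvOn.image_image h,
    LeftInvOn.image_image h', hausdorffMeasure_euclideanSpace_prod] at h1
  have h2 := hψ.hausdorffMeasure_image_le (d := (k : ℝ)) (Nat.cast_nonneg _)
  have h3 := hψ₂.hausdorffMeasure_image_le (d := (l : ℝ)) (Nat.cast_nonneg _)
  rw [ENNReal.rpow_natCast] at h1 h2 h3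
  calc _ ≤ _ := h1
    _ ≤ (c : ℝ≥0∞) ^ (k + l) * ((c ^ k * μH[(k : ℝ)] A) * (c ^ l * μH[(l : ℝ)] B)) := by gcongr
    _ = _ := by ring

lemma IsAlmostEuclidean.le_hausdorffMeasure_prod {X Y : Type*} [EMetricSpace X]
    [MeasurableSpace X] [BorelSpace X] [EMetricSpace Y] [MeasurableSpace Y] [BorelSpace Y]
    [BorelSpace (X × Y)]
    {k l : ℕ} {c : ℝ≥0} {A : Set X} {B : Set Y}
    (hA : IsAlmostEuclidean c k A) (hB : IsAlmostEuclidean c l B) :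
    μH[(k : ℝ)] A * μH[(l : ℝ)] B ≤
      (c : ℝ≥0∞) ^ (2 * (k + l)) * μH[((k + l : ℕ) : ℝ)] (A ×ˢ B) := by
  obtain ⟨φ, ψ, hψ, hφ, h⟩ := hA
  obtain ⟨φ₂, ψ₂, hψ₂, hφ₂, h'⟩ := hB
  have h1 := (lipschitzOnWith_prodMap hψ hψ₂).hausdorffMeasure_image_le
    (d := ((k + l : ℕ) : ℝ)) (Nat.cast_nonneg _)
  rw [prodMap_image_prod, hausdorffMeasure_euclideanSpace_prod] at h1
  have h2 := hφ.hausdorffMeasure_image_le (d := (k : ℝ)) (Nat.cast_nonneg _)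
  have h3 := hφ₂.hausdorffMeasure_image_le (d := (l : ℝ)) (Nat.cast_nonneg _)
  rw [LeftInvOn.image_image h] at h2
  rw [LeftInvOn.image_image h'] at h3
  rw [ENNReal.rpow_natCast] at h1 h2 h3
  calc _ ≤ (c ^ k * μH[(k : ℝ)] (ψ '' A)) * (c ^ l * μH[(l : ℝ)] (ψ₂ '' B)) := by gcongr
    _ = (c : ℝ≥0∞) ^ (k + l) * (μH[(k : ℝ)] (ψ '' A) * μH[(l : ℝ)] (ψ₂ '' B)) := by ring
    _ ≤ (c : ℝ≥0∞) ^ (k + l) * (c ^ (k + l) * μH[((k + l : ℕ) : ℝ)] (A ×ˢ B)) := by gcongr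
    _ = _ := by ring

/-- Up to a negligible set, a countably rectifiable set is covered by countably many disjoint
measurable pieces which are rectifiable and almost Euclidean. -/
lemma IsCountablyRectifiable.exists_isAlmostEuclidean_cover {k : ℕ} {F : Type*}
    [NormedAddCommGroup F] [InnerProductSpace ℝ F] [FiniteDimensional ℝ F] [MeasurableSpace F]
    [BorelSpace F] {S : Set F} (hS : IsCountablyRectifiable k S) {c : ℝ≥0} (hc : 1 < c) :
    ∃ E : ℕ → Set F, (∀ i, MeasurableSet (E i)) ∧ Pairwise (Function.onFun Disjoint E) ∧
      (∀ i, IsAlmostEuclidean c k (E i)) ∧ (∀ i, IsRectifiable k (E i)) ∧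
      μH[(k : ℝ)] (S \ ⋃ i, E i) = 0 := by
  obtain ⟨T, hT, hST⟩ := hS
  choose f K hf hTf using fun i => (hT i).exists_subset_range
  choose E hEm hEa hEf hE0 using fun i => exists_isAlmostEuclidean_cover_range (hf i) hc
  let G : ℕ → Set F := fun n => E n.unpair.1 n.unpair.2
  have hG : ∀ i j, E i j ⊆ ⋃ n, G n := fun i j =>
    subset_iUnion_of_subset (Nat.pair i j) (by simp [G])
  refine ⟨disjointed G, MeasurableSet.disjointed fun n => hEm _ _, disjoint_disjointed G,
    fun n => (hEa _ _).mono (disjointed_subset G n), fun n => ?_, ?_⟩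
  · exact ⟨f n.unpair.1, K n.unpair.1, univ, hf _, by
      rw [image_univ]; exact (disjointed_subset G n).trans (hEf _ _)⟩
  · rw [iUnion_disjointed]
    refine measure_mono_null (t := (S \ ⋃ i, T i) ∪ ⋃ i, (range (f i) \ ⋃ j, E i j)) ?_
      (measure_union_null hST (measure_iUnion_null hE0))
    rintro x ⟨hxS, hxG⟩
    by_cases hx : x ∈ ⋃ i, T i
    · obtain ⟨i, hi⟩ := mem_iUnion.1 hx
      refine Or.inr (mem_iUnion.2 ⟨i, hTf i hi, fun hx' => hxG ?_⟩)
      exact iUnion_subset (hG i) hx'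
    · exact Or.inl ⟨hxS, hx⟩

lemma IsCountablyRectifiable.sigmaFinite_restrict {k : ℕ} {X : Type*} [EMetricSpace X]
    [MeasurableSpace X] [BorelSpace X] {S : Set X} (hS : IsCountablyRectifiable k S)
    (hSm : MeasurableSet S) : SigmaFinite (μH[(k : ℝ)].restrict S) := by
  obtain ⟨T, hT, hST⟩ := hS
  choose f K hf hTf using fun i => (hT i).exists_subset_range
  have hHaar := isAddHaarMeasure_hausdorffMeasure_euclideanSpace k
  refine Measure.sigmaFinite_of_countable
    (S := insert Sᶜ (insert (S \ ⋃ i, T i)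
      (range fun p : ℕ × ℕ => f p.1 '' closedBall 0 p.2)))
    (((countable_range _).insert _).insert _) ?_ ?_
  · rintro _ (rfl | rfl | ⟨p, rfl⟩)
    · rw [Measure.restrict_apply hSm.compl]
      simp
    · exact ((Measure.restrict_apply_le _ _).trans hST.le).trans_lt ENNReal.zero_lt_top
    · refine (Measure.restrict_apply_le _ _).trans_lt
        (((hf p.1).hausdorffMeasure_image_le (Nat.cast_nonneg _) _).trans_lt ?_)
      exact ENNReal.mul_lt_top (ENNReal.rpow_lt_top_of_nonneg (Nat.cast_nonneg _)
        ENNReal.coe_ne_top) (isCompact_closedBall _ _).measure_lt_top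
  · refine eq_univ_of_forall fun x => ?_
    by_cases hxS : x ∈ S
    · by_cases hx : x ∈ ⋃ i, T i
      · obtain ⟨i, hi⟩ := mem_iUnion.1 hx
        obtain ⟨y, rfl⟩ := hTf i hi
        obtain ⟨n, hn⟩ := exists_nat_ge ‖y‖
        exact ⟨_, Or.inr (Or.inr ⟨(i, n), rfl⟩),
          mem_image_of_mem _ (mem_closedBall_zero_iff.2 hn)⟩
      · exact ⟨_, Or.inr (Or.inl rfl), hxS, hx⟩
    · exact ⟨_, Or.inl rfl, hxS⟩

lemma ENNReal.le_of_forall_one_lt_le_pow_mul {x y : ℝ≥0∞} (d : ℕ)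
    (h : ∀ c : ℝ≥0, 1 < c → x ≤ (c : ℝ≥0∞) ^ d * y) : x ≤ y := by
  rcases eq_or_ne y ∞ with rfl | hy
  · exact le_top
  lift y to ℝ≥0 using hy
  have hcont : Continuous fun c : ℝ≥0 => ((c ^ d * y : ℝ≥0) : ℝ≥0∞) :=
    ENNReal.continuous_coe.comp (by fun_prop)
  have htend := (hcont.tendsto 1).mono_left (nhdsWithin_le_nhds (s := Ioi 1))
  rw [one_pow, one_mul] at htend
  refine ge_of_tendsto htend (eventually_mem_nhdsWithin.mono fun c hc => ?_)
  simpa using h c hc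

lemma measure_eq_tsum_inter_of_measure_sdiff_iUnion {ι X : Type*} [Countable ι]
    [MeasurableSpace X] {μ : Measure X} {C : Set X} {D : ι → Set X} (hC : MeasurableSet C)
    (hD : ∀ i, MeasurableSet (D i)) (hdisj : Pairwise (Function.onFun Disjoint D))
    (h0 : μ (C \ ⋃ i, D i) = 0) : μ C = ∑' i, μ (C ∩ D i) := by
  rw [← measure_iUnion (fun i j hij => (hdisj hij).mono inter_subset_right inter_subset_right)
    fun i => hC.inter (hD i), ← inter_iUnion, ← measure_inter_add_sdiff C (MeasurableSet.iUnion hD),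
    h0, add_zero]

/-- The Hausdorff measure of a product of measurable subsets of rectifiable sets. -/
lemma IsCountablyRectifiable.hausdorffMeasure_prod {k l : ℕ} {F G : Type*}
    [NormedAddCommGroup F] [InnerProductSpace ℝ F] [FiniteDimensional ℝ F] [MeasurableSpace F]
    [BorelSpace F] [NormedAddCommGroup G] [InnerProductSpace ℝ G] [FiniteDimensional ℝ G]
    [MeasurableSpace G] [BorelSpace G] {A : Set F} {B : Set G} (hA : IsCountablyRectifiable k A)
    (hAm : MeasurableSet A) (hBm : MeasurableSet B) {T : ℕ → Set G}
    (hT : ∀ i, IsRectifiable l (T i)) (hBT : B ⊆ ⋃ i, T i) :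
    μH[((k + l : ℕ) : ℝ)] (A ×ˢ B) = μH[(k : ℝ)] A * μH[(l : ℝ)] B := by
  have hB : IsCountablyRectifiable l B :=
    ⟨T, hT, by rw [sdiff_eq_empty.2 hBT, measure_empty]⟩
  have key : ∀ c : ℝ≥0, 1 < c → ∃ (P : ℕ → Set F) (Q : ℕ → Set G),
      (∀ i, IsAlmostEuclidean c k (P i)) ∧ (∀ j, IsAlmostEuclidean c l (Q j)) ∧
      μH[(k : ℝ)] A * μH[(l : ℝ)] B = ∑' p : ℕ × ℕ, μH[(k : ℝ)] (P p.1) * μH[(l : ℝ)] (Q p.2) ∧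
      μH[((k + l : ℕ) : ℝ)] (A ×ˢ B) =
        ∑' p : ℕ × ℕ, μH[((k + l : ℕ) : ℝ)] (P p.1 ×ˢ Q p.2) := by
    intro c hc
    obtain ⟨E, hEm, hEd, hEa, hEr, hE0⟩ := hA.exists_isAlmostEuclidean_cover hc
    obtain ⟨E', hEm', hEd', hEa', hEr', hE0'⟩ := hB.exists_isAlmostEuclidean_cover hc
    refine ⟨fun i => A ∩ E i, fun j => B ∩ E' j, fun i => (hEa i).mono inter_subset_right,
      fun j => (hEa' j).mono inter_subset_right, ?_, ?_⟩
    · rw [measure_eq_tsum_inter_of_measure_sdiff_iUnion hAm hEm hEd hE0,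
        measure_eq_tsum_inter_of_measure_sdiff_iUnion hBm hEm' hEd' hE0',
        ENNReal.tsum_prod
          (f := fun i j => μH[(k : ℝ)] (A ∩ E i) * μH[(l : ℝ)] (B ∩ E' j))]
      simp_rw [ENNReal.tsum_mul_left, ENNReal.tsum_mul_right]
    · have hdisj : Pairwise (Function.onFun Disjoint fun p : ℕ × ℕ => E p.1 ×ˢ E' p.2) := by
        intro p q hpq
        rw [Function.onFun, Set.disjoint_prod]
        by_cases h : p.1 = q.1
        · exact Or.inr (hEd' fun h' => hpq (Prod.ext h h'))
        · exact Or.inl (hEd h)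
      have hnull : μH[((k + l : ℕ) : ℝ)] ((A ×ˢ B) \ ⋃ p : ℕ × ℕ, E p.1 ×ˢ E' p.2) = 0 := by
        refine measure_mono_null (t := (⋃ i, (A \ ⋃ j, E j) ×ˢ T i) ∪
          ⋃ i, E i ×ˢ (B \ ⋃ j, E' j)) ?_ (measure_union_null
          (measure_iUnion_null fun i => (hT i).hausdorffMeasure_prod_eq_zero_left hE0)
          (measure_iUnion_null fun i => (hEr i).hausdorffMeasure_prod_eq_zero_right hE0'))
        rintro ⟨x, y⟩ ⟨⟨hx, hy⟩, hxy⟩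
        by_cases hxE : x ∈ ⋃ j, E j
        · obtain ⟨i, hi⟩ := mem_iUnion.1 hxE
          refine Or.inr (mem_iUnion.2 ⟨i, hi, hy, fun hyE => hxy ?_⟩)
          obtain ⟨j, hj⟩ := mem_iUnion.1 hyE
          exact mem_iUnion.2 ⟨(i, j), hi, hj⟩
        · obtain ⟨i, hi⟩ := mem_iUnion.1 (hBT hy)
          exact Or.inl (mem_iUnion.2 ⟨i, ⟨hx, hxE⟩, hi⟩)
      rw [measure_eq_tsum_inter_of_measure_sdiff_iUnion (hAm.prod hBm)
        (fun p : ℕ × ℕ => (hEm p.1).prod (hEm' p.2)) hdisj hnull]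
      simp_rw [prod_inter_prod]
  refine le_antisymm (ENNReal.le_of_forall_one_lt_le_pow_mul (2 * (k + l)) fun c hc => ?_)
    (ENNReal.le_of_forall_one_lt_le_pow_mul (2 * (k + l)) fun c hc => ?_)
  · obtain ⟨P, Q, hP, hQ, h1, h2⟩ := key c hc
    rw [h1, h2, ← ENNReal.tsum_mul_left]
    exact ENNReal.tsum_le_tsum fun p => (hP _).hausdorffMeasure_prod_le (hQ _)
  · obtain ⟨P, Q, hP, hQ, h1, h2⟩ := key c hc
    rw [h1, h2, ← ENNReal.tsum_mul_left]
    exact ENNReal.tsum_le_tsum fun p => (hP _).le_hausdorffMeasure_prod (hQ _)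

lemma IsCountablyRectifiable.mono {k : ℕ} {X : Type*} [EMetricSpace X] [MeasurableSpace X]
    [BorelSpace X] {S S' : Set X} (hS : IsCountablyRectifiable k S) (h : S' ⊆ S) :
    IsCountablyRectifiable k S' := by
  obtain ⟨T, hT, hST⟩ := hS
  exact ⟨T, hT, measure_mono_null (sdiff_subset_sdiff_left h) hST⟩

end

/-- Fubini-type theorem for rectifiable products: if `S* ⊆ ℝⁿ` is Borel and countably
`k`-rectifiable and `S ⊆ ℝᵐ` is Borel and a countable union of `l`-rectifiable sets, then for
every nonnegative Borel `g`, `∫_{S* × S} g dH^{k+l} = ∫_{S*} ∫_S g(x,y) dH^l(y) dH^k(x)`. -/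
theorem lintegral_prod_rectifiable (k l n m : ℕ)
    (Sstar : Set (EuclideanSpace ℝ (Fin n))) (S : Set (EuclideanSpace ℝ (Fin m)))
    (hSstarBorel : MeasurableSet Sstar) (hSBorel : MeasurableSet S)
    (hSstar : IsCountablyRectifiable k Sstar)
    (T : ℕ → Set (EuclideanSpace ℝ (Fin m)))
    (hT : ∀ i, IsRectifiable l (T i)) (hS : S = ⋃ i, T i)
    (g : EuclideanSpace ℝ (Fin n) × EuclideanSpace ℝ (Fin m) → ENNReal)
    (hg : Measurable g) :
    ∫⁻ z in Sstar ×ˢ S, g z ∂(μH[((k + l : ℕ) : ℝ)]) =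
      ∫⁻ x in Sstar, ∫⁻ y in S, g (x, y) ∂(μH[(l : ℝ)]) ∂(μH[(k : ℝ)]) := by
  have hS' : IsCountablyRectifiable l S := ⟨T, hT, by rw [hS, Set.sdiff_self, measure_empty]⟩
  have := hSstar.sigmaFinite_restrict hSstarBorel
  have := hS'.sigmaFinite_restrict hSBorel
  have hprod : (μH[(k : ℝ)].restrict Sstar).prod (μH[(l : ℝ)].restrict S) =
      μH[((k + l : ℕ) : ℝ)].restrict (Sstar ×ˢ S) := by
    refine Measure.prod_eq fun s t hs ht => ?_
    rw [Measure.restrict_apply (hs.prod ht), Measure.restrict_apply hs, Measure.restrict_apply ht,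
      Set.prod_inter_prod]
    exact (hSstar.mono Set.inter_subset_right).hausdorffMeasure_prod (hs.inter hSstarBorel)
      (ht.inter hSBorel) hT (Set.inter_subset_right.trans hS.subset)
  rw [← hprod, lintegral_prod _ hg.aemeasurable]
end

section
/- Let 0 < k < n, let S ⊂ ℝⁿ be a Borel set covered by countably many k-rectifiable sets, and let S* ⊂ ℝⁿ be a Borel set covered by countably many (n−k)-rectifiable sets. Let φ : ℝⁿ → [0,∞) be a smooth function vanishing outside the closed unit ball with ∫_{ℝⁿ} φ dH^n = 1, let ε > 0, and set φ_ε(x) = ε^{-n} φ(x/ε). Suppose that for every w ∈ ℝⁿ with |w| < ε there exist x ∈ S* and y ∈ S with x − y = w. Then ∫_{S*} ∫_{S} φ_ε(x − y) dH^k(y) dH^{n−k}(x) ≥ 1. -/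
open MeasureTheory

/-- The standard (normalized) `d`-dimensional Hausdorff measure: Mathlib's (unnormalized)
Hausdorff measure multiplied by the isodiametric normalization constant `ω_d / 2^d`, where
`ω_d` is the volume of the Euclidean unit `d`-ball. With this normalization the
`n`-dimensional Hausdorff measure on `ℝⁿ` equals Lebesgue measure. -/
noncomputable def stdHausdorff (d : ℕ) (X : Type*) [EMetricSpace X] [MeasurableSpace X]
    [BorelSpace X] : Measure X :=
  (volume (Metric.ball (0 : EuclideanSpace ℝ (Fin d)) 1) / 2 ^ d) • μH[(d : ℝ)]

section

open Set
open scoped Pointwise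

theorem lintegral_eq_lintegral_measure_ofReal_lt {α : Type*} [MeasurableSpace α] (μ : Measure α)
    [SFinite μ] {f : α → ENNReal} (hf : Measurable f) :
    ∫⁻ x, f x ∂μ = ∫⁻ t in Ioi (0 : ℝ), μ {x | ENNReal.ofReal t < f x} := by
  have key : ∀ c : ENNReal,
      ∫⁻ t in Ioi (0 : ℝ), {t : ℝ | ENNReal.ofReal t < c}.indicator 1 t = c := by
    intro c
    rw [lintegral_indicator_one (measurableSet_lt (by fun_prop) measurable_const),
      Measure.restrict_apply (measurableSet_lt (by fun_prop) measurable_const)]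
    rcases eq_or_ne c ⊤ with rfl | hc
    · simp
    · have : {t : ℝ | ENNReal.ofReal t < c} ∩ Ioi 0 = Ioo 0 c.toReal := by
        ext t
        simp only [mem_inter_iff, mem_ofPred_eq, mem_Ioi, mem_Ioo]
        constructor
        · rintro ⟨h1, h2⟩
          exact ⟨h2, (ENNReal.ofReal_lt_iff_lt_toReal h2.le hc).1 h1⟩
        · rintro ⟨h1, h2⟩
          exact ⟨(ENNReal.ofReal_lt_iff_lt_toReal h1.le hc).2 h2, h1⟩
      rw [this]
      simp [hc]
  have hm : MeasurableSet {p : α × ℝ | ENNReal.ofReal p.2 < f p.1} :=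
    measurableSet_lt (by fun_prop) (by fun_prop)
  calc ∫⁻ x, f x ∂μ
      = ∫⁻ x, (∫⁻ t in Ioi (0 : ℝ),
          indicator {p : α × ℝ | ENNReal.ofReal p.2 < f p.1} (1 : α × ℝ → ENNReal) (x, t)) ∂μ := by
        refine lintegral_congr fun x => ?_
        conv_lhs => rw [← key (f x)]
        rfl
    _ = ∫⁻ t in Ioi (0 : ℝ), ∫⁻ x,
          indicator {p : α × ℝ | ENNReal.ofReal p.2 < f p.1} (1 : α × ℝ → ENNReal) (x, t) ∂μ := by
        refine lintegral_lintegral_swap ?_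
        exact (measurable_one.indicator hm).aemeasurable
    _ = _ := by
        refine lintegral_congr fun t => ?_
        rw [← lintegral_indicator_one (measurableSet_lt measurable_const hf)]
        rfl

theorem volume_add_volume_le_of_compact_midpoint {A B C : Set ℝ} (hA : IsCompact A)
    (hB : IsCompact B) (hA' : A.Nonempty) (hB' : B.Nonempty)
    (h : ∀ x ∈ A, ∀ y ∈ B, (x + y) / 2 ∈ C) : volume A + volume B ≤ 2 * volume C := by
  have hD : volume ((2 : ℝ) • C) = 2 * volume C := by
    rw [Measure.addHaar_smul]; simp
  have hD' : ∀ x ∈ A, ∀ y ∈ B, x + y ∈ (2 : ℝ) • C := fun x hx y hy =>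
    ⟨(x + y) / 2, h x hx y hy, by simp; ring⟩
  set M := sSup A
  set m := sInf B
  have hM : M ∈ A := hA.sSup_mem hA'
  have hm : m ∈ B := hB.sInf_mem hB'
  have hP : volume ((fun x => x + m) '' A) = volume A := by simp
  have hQ : volume ((fun y => M + y) '' B) = volume B := by simp
  rw [← hD, ← hP, ← hQ, ← measure_union₀]
  · apply measure_mono
    rintro _ (⟨x, hx, rfl⟩ | ⟨y, hy, rfl⟩)
    · exact hD' x hx m hm
    · exact hD' M hM y hy
  · exact (hB.image (by fun_prop)).measurableSet.nullMeasurableSet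
  · refine measure_mono_null (t := {M + m}) ?_ (by simp)
    rintro _ ⟨⟨x, hx, rfl⟩, ⟨y, hy, hxy⟩⟩
    have h1 : x ≤ M := le_csSup hA.bddAbove hx
    have h2 : m ≤ y := csInf_le hB.bddBelow hy
    simp only at hxy
    simp only [mem_singleton_iff]
    linarith

theorem volume_add_volume_le_of_midpoint {A B C : Set ℝ} (hA : MeasurableSet A)
    (hB : MeasurableSet B) (hA' : A.Nonempty) (hB' : B.Nonempty)
    (h : ∀ x ∈ A, ∀ y ∈ B, (x + y) / 2 ∈ C) : volume A + volume B ≤ 2 * volume C := by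
  obtain ⟨a, ha⟩ := hA'
  obtain ⟨b, hb⟩ := hB'
  rw [hA.measure_eq_iSup_isCompact, hB.measure_eq_iSup_isCompact]
  simp_rw [iSup_and']
  refine ENNReal.biSup_add_biSup_le' ⟨∅, by simp⟩ ⟨∅, by simp⟩ fun K hK K' hK' => ?_
  refine le_trans (add_le_add (measure_mono (subset_insert a K)) (measure_mono (subset_insert b K')))
    (volume_add_volume_le_of_compact_midpoint (hK.2.insert a) (hK'.2.insert b)
      (insert_nonempty _ _) (insert_nonempty _ _) fun x hx y hy => ?_)
  exact h x (insert_subset ha hK.1 hx) y (insert_subset hb hK'.1 hy)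

theorem ENNReal.mul_le_sq_of_add_le_two_mul {p q r : ENNReal} (h : p + q ≤ 2 * r) :
    p * q ≤ r ^ 2 := by
  rcases eq_or_ne r ⊤ with rfl | hr
  · simp
  have hp : p ≠ ⊤ := ne_top_of_le_ne_top (ENNReal.mul_ne_top (by simp) hr) (le_self_add.trans h)
  have hq : q ≠ ⊤ := ne_top_of_le_ne_top (ENNReal.mul_ne_top (by simp) hr) (le_add_self.trans h)
  lift p to NNReal using hp
  lift q to NNReal using hq
  lift r to NNReal using hr
  norm_cast at h ⊢
  rw [← NNReal.coe_le_coe] at h ⊢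
  push_cast at h ⊢
  nlinarith [sq_nonneg ((p : ℝ) - q), p.2, q.2, r.2, p.coe_nonneg, q.coe_nonneg]

theorem prekopaLeindler_real_of_iSup_eq_one {f g h : ℝ → ENNReal} (hf : Measurable f)
    (hg : Measurable g) (hh : Measurable h) (hf1 : ⨆ x, f x = 1) (hg1 : ⨆ x, g x = 1)
    (H : ∀ x y, f x * g y ≤ h ((x + y) / 2) ^ 2) :
    (∫⁻ x, f x) * ∫⁻ x, g x ≤ (∫⁻ x, h x) ^ 2 := by
  apply ENNReal.mul_le_sq_of_add_le_two_mul
  have aux : ∀ u : ℝ → ENNReal, Measurable u → ⨆ x, u x = 1 →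
      ∫⁻ x, u x = ∫⁻ t in Ioo (0 : ℝ) 1, volume {x | ENNReal.ofReal t < u x} := by
    intro u hu hu1
    rw [lintegral_eq_lintegral_measure_ofReal_lt _ hu,
      ← Ioo_union_Ici_eq_Ioi zero_lt_one, lintegral_union measurableSet_Ici
      (by rw [Set.disjoint_left]; intro x hx hx'; exact absurd hx.2 (not_lt.2 hx'))]
    rw [setLIntegral_congr_fun (g := 0) measurableSet_Ici]
    · simp
    · intro t ht
      have : {x | ENNReal.ofReal t < u x} = ∅ := by
        ext x
        simp only [mem_ofPred_eq, mem_empty_iff_false, iff_false, not_lt]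
        refine (le_iSup u x).trans ?_
        rw [hu1]
        simpa using ht
      simp [this]
  rw [aux f hf hf1, aux g hg hg1, lintegral_eq_lintegral_measure_ofReal_lt _ hh]
  calc _ ≤ ∫⁻ t in Ioo (0 : ℝ) 1, (volume {x | ENNReal.ofReal t < f x} +
        volume {x | ENNReal.ofReal t < g x}) := le_lintegral_add _ _
    _ ≤ ∫⁻ t in Ioo (0 : ℝ) 1, 2 * volume {x | ENNReal.ofReal t < h x} := by
        refine setLIntegral_mono' measurableSet_Ioo fun t ht => ?_
        have ht1 : ENNReal.ofReal t < 1 := by simpa using ht.2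
        apply volume_add_volume_le_of_midpoint (measurableSet_lt measurable_const hf)
          (measurableSet_lt measurable_const hg)
        · exact lt_iSup_iff.1 (hf1 ▸ ht1)
        · exact lt_iSup_iff.1 (hg1 ▸ ht1)
        · intro x hx y hy
          simp only [mem_ofPred_eq] at hx hy ⊢
          by_contra! hcon
          have h1 := H x y
          have h2 : ENNReal.ofReal t * ENNReal.ofReal t < f x * g y := ENNReal.mul_lt_mul hx hy
          have h3 : h ((x + y) / 2) ^ 2 ≤ ENNReal.ofReal t * ENNReal.ofReal t := by
            rw [← sq]; gcongr
          exact absurd (h2.trans_le h1) (not_lt.2 h3)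
    _ = 2 * ∫⁻ t in Ioo (0 : ℝ) 1, volume {x | ENNReal.ofReal t < h x} := by
        rw [lintegral_const_mul' _ _ (by simp)]
    _ ≤ _ := by
        gcongr
        exact Ioo_subset_Ioi_self

theorem prekopaLeindler_real_of_bounded {f g h : ℝ → ENNReal} (hf : Measurable f)
    (hg : Measurable g) (hh : Measurable h) (hfb : ⨆ x, f x ≠ ⊤) (hgb : ⨆ x, g x ≠ ⊤)
    (H : ∀ x y, f x * g y ≤ h ((x + y) / 2) ^ 2) :
    (∫⁻ x, f x) * ∫⁻ x, g x ≤ (∫⁻ x, h x) ^ 2 := by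
  set a := ⨆ x, f x with ha
  set b := ⨆ x, g x with hb
  rcases eq_or_ne a 0 with ha0 | ha0
  · have : ∀ x, f x = 0 := by simpa [ha, iSup_eq_bot] using ha0
    simp [this]
  rcases eq_or_ne b 0 with hb0 | hb0
  · have : ∀ x, g x = 0 := by simpa [hb, iSup_eq_bot] using hb0
    simp [this]
  set c : ENNReal := (a * b) ^ (1 / 2 : ℝ) with hc
  have hab : a * b ≠ ⊤ := ENNReal.mul_ne_top hfb hgb
  have hab0 : a * b ≠ 0 := mul_ne_zero ha0 hb0
  have hc2 : c ^ 2 = a * b := by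
    rw [hc, ← ENNReal.rpow_natCast, ← ENNReal.rpow_mul]; norm_num
  have main := prekopaLeindler_real_of_iSup_eq_one (f := fun x => a⁻¹ * f x)
    (g := fun x => b⁻¹ * g x) (h := fun x => c⁻¹ * h x) (hf.const_mul _) (hg.const_mul _)
    (hh.const_mul _) (by rw [← ENNReal.mul_iSup, ENNReal.inv_mul_cancel ha0 hfb])
    (by rw [← ENNReal.mul_iSup, ENNReal.inv_mul_cancel hb0 hgb]) (by
      intro x y
      rw [mul_pow, ← ENNReal.inv_pow, hc2, ENNReal.mul_inv (.inl ha0) (.inl hfb), mul_mul_mul_comm]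
      gcongr
      exact H x y)
  rw [lintegral_const_mul _ hf, lintegral_const_mul _ hg, lintegral_const_mul _ hh, mul_pow,
    ← ENNReal.inv_pow, hc2, mul_mul_mul_comm, ← ENNReal.mul_inv (.inl ha0) (.inl hfb)] at main
  rwa [ENNReal.mul_le_mul_iff_right (by simpa using hab) (by simpa using hab0)] at main

theorem prekopaLeindler_real {f g h : ℝ → ENNReal} (hf : Measurable f)
    (hg : Measurable g) (hh : Measurable h)
    (H : ∀ x y, f x * g y ≤ h ((x + y) / 2) ^ 2) :
    (∫⁻ x, f x) * ∫⁻ x, g x ≤ (∫⁻ x, h x) ^ 2 := by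
  have trunc : ∀ u : ℝ → ENNReal, Measurable u →
      ∫⁻ x, u x = ⨆ N : ℕ, ∫⁻ x, min (u x) N := by
    intro u hu
    rw [← lintegral_iSup (fun N => hu.min measurable_const)]
    · refine lintegral_congr fun x => ?_
      rw [← inf_iSup_eq, ENNReal.iSup_natCast, inf_top_eq]
    · intro i j hij x
      simp only
      gcongr
  rw [trunc f hf, trunc g hg, ENNReal.iSup_mul]
  refine iSup_le fun N => ?_
  rw [ENNReal.mul_iSup]
  refine iSup_le fun N' => ?_
  have bdd : ∀ (u : ℝ → ENNReal) (N : ℕ), ⨆ x, min (u x) N ≠ ⊤ := fun u N =>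
    ne_top_of_le_ne_top (ENNReal.natCast_ne_top N) (iSup_le fun x => min_le_right _ _)
  refine prekopaLeindler_real_of_bounded (hf.min measurable_const) (hg.min measurable_const) hh
    (bdd f N) (bdd g N') fun x y => le_trans ?_ (H x y)
  exact mul_le_mul' (min_le_left _ _) (min_le_left _ _)

theorem prekopaLeindler_pi (n : ℕ) {f g h : (Fin n → ℝ) → ENNReal} (hf : Measurable f)
    (hg : Measurable g) (hh : Measurable h)
    (H : ∀ x y, f x * g y ≤ h ((2 : ℝ)⁻¹ • (x + y)) ^ 2) :
    (∫⁻ x, f x) * ∫⁻ x, g x ≤ (∫⁻ x, h x) ^ 2 := by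
  induction n with
  | zero =>
    have := H 0 0
    have e : ∀ u : (Fin 0 → ℝ) → ENNReal, ∫⁻ x, u x = u 0 := by
      intro u
      rw [lintegral_unique]
      simp only [volume_pi, Measure.pi_empty_univ, mul_one]
      exact congrArg u (Subsingleton.elim _ _)
    rw [e, e, e]
    simpa using this
  | succ n ih =>
    have mp := (volume_preserving_piFinSuccAbove (fun _ : Fin (n + 1) => ℝ) 0).symm
    have cons_meas : Measurable fun p : ℝ × (Fin n → ℝ) => (Fin.cons p.1 p.2 : Fin (n + 1) → ℝ) := by
      refine measurable_pi_lambda _ fun i => ?_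
      refine Fin.cases ?_ (fun i => ?_) i
      · simpa using measurable_fst
      · simp only [Fin.cons_succ]; fun_prop
    have e : ∀ u : (Fin (n + 1) → ℝ) → ENNReal, Measurable u →
        ∫⁻ x, u x = ∫⁻ s : ℝ, ∫⁻ y : Fin n → ℝ, u (Fin.cons s y) := by
      intro u hu
      rw [← mp.lintegral_comp hu, Measure.volume_eq_prod, lintegral_prod]
      · refine lintegral_congr fun s => lintegral_congr fun y => congrArg u ?_
        exact Fin.insertNth_zero' s y
      · exact (hu.comp mp.measurable).aemeasurable
    have meas : ∀ u : (Fin (n + 1) → ℝ) → ENNReal, Measurable u →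
        Measurable fun s : ℝ => ∫⁻ y : Fin n → ℝ, u (Fin.cons s y) := fun u hu =>
      (hu.comp cons_meas).lintegral_prod_right'
    rw [e f hf, e g hg, e h hh]
    refine prekopaLeindler_real (meas f hf) (meas g hg) (meas h hh) fun s t => ?_
    refine ih (hf.comp (cons_meas.comp measurable_prodMk_left))
      (hg.comp (cons_meas.comp measurable_prodMk_left))
      (hh.comp (cons_meas.comp measurable_prodMk_left)) fun x y => ?_
    refine (H _ _).trans_eq ?_
    congr 2
    ext i
    refine Fin.cases ?_ (fun i => ?_) i
    · simp; ring
    · simp; ring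

theorem prekopaLeindler_euclideanSpace (n : ℕ) {f g h : EuclideanSpace ℝ (Fin n) → ENNReal}
    (hf : Measurable f) (hg : Measurable g) (hh : Measurable h)
    (H : ∀ x y, f x * g y ≤ h ((2 : ℝ)⁻¹ • (x + y)) ^ 2) :
    (∫⁻ x, f x) * ∫⁻ x, g x ≤ (∫⁻ x, h x) ^ 2 := by
  have mp := PiLp.volume_preserving_toLp (Fin n)
  rw [← mp.lintegral_comp hf, ← mp.lintegral_comp hg, ← mp.lintegral_comp hh]
  exact prekopaLeindler_pi n (hf.comp mp.measurable) (hg.comp mp.measurable)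
    (hh.comp mp.measurable) fun x y => H _ _

/-- The **isodiametric inequality**. -/
theorem volume_le_ediam_pow (n : ℕ) {s : Set (EuclideanSpace ℝ (Fin n))}
    (hs : Metric.ediam s ≠ ⊤) :
    volume s ≤ volume (Metric.ball (0 : EuclideanSpace ℝ (Fin n)) 1) / 2 ^ n *
      Metric.ediam s ^ (n : ℝ) := by
  set K := closure s with hK_def
  have hKd : Metric.ediam K = Metric.ediam s := Metric.ediam_closure s
  have hKb : Bornology.IsBounded K := Metric.isBounded_iff_ediam_ne_top.2 (hKd ▸ hs)
  have hK : IsCompact K := Metric.isCompact_of_isClosed_isBounded isClosed_closure hKb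
  set C : Set (EuclideanSpace ℝ (Fin n)) := (fun p : (EuclideanSpace ℝ (Fin n)) × (EuclideanSpace ℝ (Fin n)) => (2 : ℝ)⁻¹ • (p.1 - p.2)) '' (K ×ˢ K)
  have hC : IsCompact C := (hK.prod hK).image (by fun_prop)
  set d := Metric.diam s
  have hCd : C ⊆ Metric.closedBall 0 (d / 2) := by
    rintro _ ⟨⟨x, y⟩, ⟨hx, hy⟩, rfl⟩
    have := Metric.dist_le_diam_of_mem hKb hx hy
    rw [Metric.diam_closure, dist_eq_norm] at this
    rw [mem_closedBall_zero_iff, norm_smul]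
    norm_num
    linarith
  have hsq : volume K * volume K ≤ volume C ^ 2 := by
    have hneg : volume (-K) = volume K := Measure.measure_neg _ _
    have := prekopaLeindler_euclideanSpace n (f := K.indicator 1) (g := (-K).indicator 1)
      (h := C.indicator 1) (measurable_one.indicator hK.measurableSet)
      (measurable_one.indicator hK.neg.measurableSet)
      (measurable_one.indicator hC.measurableSet) (by
        intro x y
        by_cases hx : x ∈ K
        · by_cases hy : y ∈ -K
          · have : (2 : ℝ)⁻¹ • (x + y) ∈ C := ⟨(x, -y), ⟨hx, hy⟩, by simp⟩
            simp only [indicator_of_mem hx, indicator_of_mem hy, indicator_of_mem this]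
            simp
          · simp [hy]
        · simp [hx])
    rwa [lintegral_indicator_one hK.measurableSet, lintegral_indicator_one hK.neg.measurableSet,
      lintegral_indicator_one hC.measurableSet, hneg] at this
  have hKC : volume K ≤ volume C := by
    rw [← sq] at hsq
    exact (ENNReal.pow_le_pow_left_iff two_ne_zero).1 hsq
  calc volume s ≤ volume K := measure_mono subset_closure
    _ ≤ volume C := hKC
    _ ≤ volume (Metric.closedBall (0 : EuclideanSpace ℝ (Fin n)) (d / 2)) := measure_mono hCd
    _ = ENNReal.ofReal ((d / 2) ^ n) * volume (Metric.ball (0 : EuclideanSpace ℝ (Fin n)) 1) := by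
        rw [Measure.addHaar_closedBall _ _ (by positivity)]; simp
    _ = _ := by
        rw [div_pow, ENNReal.ofReal_div_of_pos (by positivity), ENNReal.ofReal_pow Metric.diam_nonneg,
          Metric.diam, ENNReal.ofReal_toReal hs, ENNReal.rpow_natCast, ENNReal.ofReal_pow (by simp)]
        simp only [ENNReal.ofReal_ofNat, div_eq_mul_inv]
        ring

theorem hausdorffNormalization_ne_zero (n : ℕ) :
    volume (Metric.ball (0 : EuclideanSpace ℝ (Fin n)) 1) / 2 ^ n ≠ 0 := by
  simp only [ne_eq, ENNReal.div_eq_zero_iff, not_or]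
  exact ⟨(Metric.measure_ball_pos _ _ one_pos).ne', by simp⟩

theorem hausdorffNormalization_ne_top (n : ℕ) :
    volume (Metric.ball (0 : EuclideanSpace ℝ (Fin n)) 1) / 2 ^ n ≠ ⊤ :=
  ENNReal.div_ne_top measure_ball_lt_top.ne (by simp)

theorem volume_le_stdHausdorff (n : ℕ) :
    (volume : Measure (EuclideanSpace ℝ (Fin n))) ≤ stdHausdorff n _ := by
  have h0 := hausdorffNormalization_ne_zero n
  have ht := hausdorffNormalization_ne_top n
  unfold stdHausdorff
  set c := volume (Metric.ball (0 : EuclideanSpace ℝ (Fin n)) 1) / 2 ^ n with hc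
  have key : c⁻¹ • (volume : Measure (EuclideanSpace ℝ (Fin n))) ≤ μH[(n : ℝ)] := by
    refine Measure.le_hausdorffMeasure _ _ 1 one_pos fun s hs => ?_
    rw [Measure.smul_apply, smul_eq_mul, ENNReal.inv_mul_le_iff h0 ht]
    exact volume_le_ediam_pow n (ne_top_of_le_ne_top ENNReal.one_ne_top hs)
  calc volume = c • c⁻¹ • (volume : Measure (EuclideanSpace ℝ (Fin n))) := by
        rw [smul_smul, ENNReal.mul_inv_cancel h0 ht, one_smul]
    _ ≤ _ := by
      refine Measure.le_iff.2 fun s _ => ?_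
      simp only [Measure.smul_apply, smul_eq_mul] at key ⊢
      gcongr
      simpa using key s

theorem stdHausdorff_le_volume_of_isOpen (n : ℕ) {U : Set (EuclideanSpace ℝ (Fin n))}
    (hU : IsOpen U) : stdHausdorff n _ U ≤ volume U := by
  have h0 := hausdorffNormalization_ne_zero n
  have ht := hausdorffNormalization_ne_top n
  have hdiam : ∀ (x : EuclideanSpace ℝ (Fin n)) {r : ℝ}, 0 ≤ r →
      Metric.ediam (Metric.closedBall x r) ≤ 2 * ENNReal.ofReal r := by
    intro x r hr
    rw [← Metric.closedEBall_ofReal hr]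
    exact Metric.ediam_closedEBall_le
  have cover : ∀ j : ℕ, ∃ (t : Set (EuclideanSpace ℝ (Fin n))) (r : (EuclideanSpace ℝ (Fin n)) → ℝ), t.Countable ∧ t ⊆ U ∧
      (∀ x ∈ t, r x ∈ {r | Metric.closedBall x r ⊆ U} ∩ Ioo 0 (1 / ((j : ℝ) + 1))) ∧
      volume (U \ ⋃ x ∈ t, Metric.closedBall x (r x)) = 0 ∧
      t.PairwiseDisjoint fun x => Metric.closedBall x (r x) := by
    intro j
    refine Besicovitch.exists_disjoint_closedBall_covering_ae volume
      (fun x => {r | Metric.closedBall x r ⊆ U}) U ?_ (fun _ => 1 / ((j : ℝ) + 1))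
      (fun _ _ => by positivity)
    intro x hx δ hδ
    obtain ⟨ρ, hρ, hρU⟩ := Metric.isOpen_iff.1 hU x hx
    refine ⟨min ρ δ / 2, ?_, by positivity, ?_⟩
    · refine (Metric.closedBall_subset_ball ?_).trans hρU
      have := min_le_left ρ δ
      linarith [lt_min hρ hδ]
    · have := min_le_right ρ δ
      linarith [lt_min hρ hδ]
  choose t r htc htU hr hnull hdisj using cover
  set N : Set (EuclideanSpace ℝ (Fin n)) := ⋃ j, (U \ ⋃ x ∈ t j, Metric.closedBall x (r j x))
  have hN : stdHausdorff n (EuclideanSpace ℝ (Fin n)) N = 0 := by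
    have : volume N = 0 := measure_iUnion_null hnull
    unfold stdHausdorff
    rw [Measure.smul_apply, Measure.absolutelyContinuous_isAddHaarMeasure μH[(n : ℝ)] volume this,
      smul_zero]
  have hUN : stdHausdorff n (EuclideanSpace ℝ (Fin n)) (U \ N) ≤ volume U := by
    have : ∀ j, Countable (t j) := fun j => (htc j).to_subtype
    unfold stdHausdorff
    rw [Measure.smul_apply, smul_eq_mul, mul_comm, ← ENNReal.le_div_iff_mul_le (.inl h0) (.inl ht)]
    refine (Measure.hausdorffMeasure_le_liminf_tsum (ι := fun j => t j) (l := Filter.atTop) n (U \ N)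
      (fun j : ℕ => 2 * ENNReal.ofReal (1 / ((j : ℝ) + 1))) ?_
      (fun j x => Metric.closedBall (x : EuclideanSpace ℝ (Fin n)) (r j x)) ?_ ?_).trans ?_
    · have h1 := ENNReal.tendsto_ofReal (tendsto_one_div_add_atTop_nhds_zero_nat (𝕜 := ℝ))
      have h2 := ENNReal.Tendsto.const_mul (a := 2) h1 (.inr (by simp))
      simpa using h2
    · refine Filter.Eventually.of_forall fun j x => ?_
      have hx := (hr j x x.2).2
      refine (hdiam _ hx.1.le).trans ?_
      gcongr
      exact hx.2.le
    · refine Filter.Eventually.of_forall fun j x hx => ?_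
      by_contra hcon
      refine hx.2 (mem_iUnion.2 ⟨j, hx.1, ?_⟩)
      simpa using hcon
    · refine (Filter.liminf_le_liminf (Filter.Eventually.of_forall fun j => ?_)).trans_eq
        (Filter.liminf_const (volume U / (volume (Metric.ball (0 : EuclideanSpace ℝ (Fin n)) 1) / 2 ^ n)))
      rw [ENNReal.le_div_iff_mul_le (.inl h0) (.inl ht), mul_comm, ← ENNReal.tsum_mul_left]
      calc _ ≤ ∑' x : t j, volume (Metric.closedBall (x : EuclideanSpace ℝ (Fin n)) (r j x)) := by
            refine ENNReal.tsum_le_tsum fun x => ?_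
            have hpos : 0 < r j x := (hr j x x.2).2.1
            rw [Measure.addHaar_closedBall _ _ hpos.le, mul_comm (ENNReal.ofReal _)]
            simp only [finrank_euclideanSpace, Fintype.card_fin]
            rw [ENNReal.rpow_natCast, ENNReal.div_eq_inv_mul, mul_comm (2 ^ n)⁻¹, mul_assoc]
            gcongr
            calc (2 ^ n)⁻¹ * Metric.ediam (Metric.closedBall (x : EuclideanSpace ℝ (Fin n)) (r j x)) ^ n
                ≤ (2 ^ n)⁻¹ * (2 * ENNReal.ofReal (r j x)) ^ n := by
                  gcongr
                  exact hdiam _ hpos.le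
              _ = ENNReal.ofReal (r j x ^ n) := by
                  rw [mul_pow, ← mul_assoc, ENNReal.inv_mul_cancel (by simp) (by simp), one_mul,
                    ENNReal.ofReal_pow hpos.le]
        _ = volume (⋃ x : t j, Metric.closedBall (x : EuclideanSpace ℝ (Fin n)) (r j x)) := by
            rw [measure_iUnion]
            · exact fun x y hxy => hdisj j x.2 y.2 (Subtype.coe_injective.ne hxy)
            · exact fun _ => Metric.isClosed_closedBall.measurableSet
        _ ≤ volume U := measure_mono (iUnion_subset fun x => (hr j x x.2).1)
  calc stdHausdorff n (EuclideanSpace ℝ (Fin n)) U ≤ stdHausdorff n (EuclideanSpace ℝ (Fin n)) (N ∪ U \ N) := measure_mono (by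
        intro x hx; by_cases h : x ∈ N; exacts [.inl h, .inr ⟨hx, h⟩])
    _ ≤ stdHausdorff n (EuclideanSpace ℝ (Fin n)) N + stdHausdorff n (EuclideanSpace ℝ (Fin n)) (U \ N) := measure_union_le _ _
    _ ≤ volume U := by rw [hN, zero_add]; exact hUN

/-- On `ℝⁿ`, the normalized `n`-dimensional Hausdorff measure is Lebesgue measure. -/
theorem stdHausdorff_eq_volume (n : ℕ) :
    stdHausdorff n (EuclideanSpace ℝ (Fin n)) = volume := by
  refine le_antisymm (Measure.le_iff'.2 fun s => ?_) (volume_le_stdHausdorff n)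
  rw [s.measure_eq_iInf_isOpen volume]
  exact le_iInf₂ fun U hsU => le_iInf fun hU =>
    (measure_mono hsU).trans (stdHausdorff_le_volume_of_isOpen n hU)

open scoped NNReal in
/-- A bound on the determinant controls the measure of images under maps approximated by linear
maps, uniformly over bounded sets of linear maps. -/
theorem exists_addHaar_image_le_mul_of_abs_det_le_one {E : Type*} [NormedAddCommGroup E]
    [NormedSpace ℝ E] [FiniteDimensional ℝ E] [MeasurableSpace E] [BorelSpace E] (μ : Measure E)
    [μ.IsAddHaarMeasure] (R : ℝ) {c : ℝ≥0} (hc : 1 < c) :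
    ∃ δ : ℝ≥0, 0 < δ ∧ ∀ A : E →L[ℝ] E, ‖A‖ ≤ R → |A.det| ≤ 1 → ∀ (s : Set E) (f : E → E),
      ApproximatesLinearOn f A s δ → μ (f '' s) ≤ c * μ s := by
  have hK : IsCompact {A : E →L[ℝ] E | ‖A‖ ≤ R ∧ |A.det| ≤ 1} := by
    have : {A : E →L[ℝ] E | ‖A‖ ≤ R ∧ |A.det| ≤ 1} =
        Metric.closedBall 0 R ∩ {A : E →L[ℝ] E | |A.det| ≤ 1} := by
      ext A; simp
    rw [this]
    exact (isCompact_closedBall _ _).inter_right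
      (isClosed_le (ContinuousLinearMap.continuous_det.abs) continuous_const)
  have key : ∀ A ∈ {A : E →L[ℝ] E | ‖A‖ ≤ R ∧ |A.det| ≤ 1}, ∃ δ : ℝ≥0, 0 < δ ∧
      ∀ (s : Set E) (f : E → E), ApproximatesLinearOn f A s δ → μ (f '' s) ≤ c * μ s := by
    intro A hA
    have hlt : ENNReal.ofReal |A.det| < c :=
      (ENNReal.ofReal_le_one.2 hA.2).trans_lt (by exact_mod_cast hc)
    obtain ⟨δ, h1, h2⟩ :=
      ((addHaar_image_le_mul_of_det_lt μ A hlt).and self_mem_nhdsWithin).exists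
    exact ⟨δ, h2, h1⟩
  choose! δ hδ hδ' using key
  obtain ⟨t, ht, hcov⟩ := hK.elim_nhds_subcover (fun A => Metric.ball A (δ A / 2))
    fun A hA => Metric.ball_mem_nhds _ (by have := hδ A hA; positivity)
  rcases t.eq_empty_or_nonempty with rfl | hne
  · refine ⟨1, one_pos, fun A h1 h2 => ?_⟩
    have : A ∈ (∅ : Set (E →L[ℝ] E)) := by simpa using hcov (show A ∈ _ from ⟨h1, h2⟩)
    exact this.elim
  · obtain ⟨A₀, hA₀, hmin⟩ := t.exists_min_image δ hne
    refine ⟨δ A₀ / 2, half_pos (hδ _ (ht _ hA₀)), fun A h1 h2 s f hf => ?_⟩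
    obtain ⟨B, hB, hAB⟩ := mem_iUnion₂.1 (hcov (show A ∈ _ from ⟨h1, h2⟩))
    refine hδ' B (ht _ hB) s f ?_
    intro x hx y hy
    have e : f x - f y - B (x - y) = (f x - f y - A (x - y)) + (A - B) (x - y) := by
      simp only [sub_apply]; abel
    rw [e]
    refine (norm_add_le _ _).trans ?_
    have h3 := hf x hx y hy
    have h4 : ‖(A - B) (x - y)‖ ≤ δ B / 2 * ‖x - y‖ :=
      ((A - B).le_opNorm _).trans (by
        gcongr; rw [← dist_eq_norm]; exact (Metric.mem_ball.1 hAB).le)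
    have h5 : (δ A₀ : ℝ) ≤ δ B := hmin B hB
    have h6 : ((δ A₀ / 2 : ℝ≥0) : ℝ) * ‖x - y‖ ≤ δ B / 2 * ‖x - y‖ := by
      push_cast; gcongr
    linarith

/-- Sard's theorem for Lipschitz maps between spaces of the same dimension. -/
theorem LipschitzWith.volume_image_eq_zero {n : ℕ} {K : NNReal}
    {f : EuclideanSpace ℝ (Fin n) → EuclideanSpace ℝ (Fin n)} (hf : LipschitzWith K f)
    {s : Set (EuclideanSpace ℝ (Fin n))}
    (hs : ∀ x ∈ s, DifferentiableAt ℝ f x → (fderiv ℝ f x).det = 0) : volume (f '' s) = 0 := by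
  have h1 : volume (f '' (s ∩ {x | DifferentiableAt ℝ f x})) = 0 :=
    addHaar_image_eq_zero_of_det_fderivWithin_eq_zero volume
      (fun x hx => (hx.2.hasFDerivAt).hasFDerivWithinAt) fun x hx => hs x hx.1 hx.2
  have h2 : volume (f '' {x | DifferentiableAt ℝ f x}ᶜ) = 0 := by
    have h3 : μH[(n : ℝ)] {x | DifferentiableAt ℝ f x}ᶜ = 0 := by
      have h : volume {x | DifferentiableAt ℝ f x}ᶜ = 0 := hf.ae_differentiableAt
      rw [← stdHausdorff_eq_volume, stdHausdorff, Measure.smul_apply, smul_eq_mul] at h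
      exact (mul_eq_zero.1 h).resolve_left (hausdorffNormalization_ne_zero n)
    have h4 := hf.hausdorffMeasure_image_le (d := n) (Nat.cast_nonneg n)
      {x | DifferentiableAt ℝ f x}ᶜ
    rw [h3, mul_zero] at h4
    rw [← stdHausdorff_eq_volume, stdHausdorff, Measure.smul_apply, nonpos_iff_eq_zero.1 h4,
      smul_zero]
  refine measure_mono_null ?_ (measure_union_null h1 h2)
  rw [← image_union]
  exact image_mono fun x hx => by
    by_cases h : DifferentiableAt ℝ f x
    exacts [.inl ⟨hx, h⟩, .inr h]

/-- Hadamard's inequality. -/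
theorem abs_det_le_prod_norm {n : ℕ}
    (A : EuclideanSpace ℝ (Fin n) →L[ℝ] EuclideanSpace ℝ (Fin n)) :
    |A.det| ≤ ∏ i, ‖A (EuclideanSpace.basisFun (Fin n) ℝ i)‖ := by
  have : Fact (Module.finrank ℝ (EuclideanSpace ℝ (Fin n)) = n) := ⟨by simp⟩
  let b := EuclideanSpace.basisFun (Fin n) ℝ
  let o := b.toBasis.orientation
  have h1 := o.abs_volumeForm_apply_le (fun i => A (b i))
  have h2 : o.volumeForm = b.toBasis.det := o.volumeForm_robust b rfl
  have h3 := b.toBasis.det_comp (A : EuclideanSpace ℝ (Fin n) →ₗ[ℝ] EuclideanSpace ℝ (Fin n)) b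
  rw [h2] at h1
  have h4 : b.toBasis.det b = 1 := by simpa using b.toBasis.det_self
  rw [h4, mul_one] at h3
  change |b.toBasis.det (A ∘ b)| ≤ _ at h1
  erw [h3] at h1
  exact h1

theorem EuclideanSpace.volume_preserving_finAddEquivProd (m k : ℕ) :
    MeasurePreserving (EuclideanSpace.finAddEquivProd (𝕜 := ℝ) (n := m) (m := k)) := by
  have h1 := (LinearIsometryEquiv.piLpCongrLeft 2 ℝ ℝ
    (finSumFinEquiv (m := m) (n := k)).symm).measurePreserving
  have h2 := (PiLp.sumPiLpEquivProdLpPiLp (𝕜 := ℝ) 2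
    (fun _ : Fin m ⊕ Fin k => ℝ)).measurePreserving
  exact (WithLp.volume_preserving_ofLp (U := EuclideanSpace ℝ (Fin m))
    (V := EuclideanSpace ℝ (Fin k))).comp (h2.comp h1)

theorem EuclideanSpace.norm_sq_finAddEquivProd {m k : ℕ} (z : EuclideanSpace ℝ (Fin (m + k))) :
    ‖(EuclideanSpace.finAddEquivProd z).1‖ ^ 2 + ‖(EuclideanSpace.finAddEquivProd z).2‖ ^ 2 =
      ‖z‖ ^ 2 := by
  rw [EuclideanSpace.norm_sq_eq, EuclideanSpace.norm_sq_eq, EuclideanSpace.norm_sq_eq,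
    Fin.sum_univ_add]
  rfl

theorem EuclideanSpace.norm_finAddEquivProd_fst_le {m k : ℕ}
    (z : EuclideanSpace ℝ (Fin (m + k))) : ‖(EuclideanSpace.finAddEquivProd z).1‖ ≤ ‖z‖ :=
  le_of_sq_le_sq (by
    nlinarith [EuclideanSpace.norm_sq_finAddEquivProd z,
      sq_nonneg ‖(EuclideanSpace.finAddEquivProd z).2‖]) (norm_nonneg _)

theorem EuclideanSpace.norm_finAddEquivProd_snd_le {m k : ℕ}
    (z : EuclideanSpace ℝ (Fin (m + k))) : ‖(EuclideanSpace.finAddEquivProd z).2‖ ≤ ‖z‖ :=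
  le_of_sq_le_sq (by
    nlinarith [EuclideanSpace.norm_sq_finAddEquivProd z,
      sq_nonneg ‖(EuclideanSpace.finAddEquivProd z).1‖]) (norm_nonneg _)

/-- The difference map of two linear isometries, on the orthogonal sum of their domains. -/
noncomputable def isometryDiff {m k : ℕ}
    (ι' : EuclideanSpace ℝ (Fin m) →ₗᵢ[ℝ] EuclideanSpace ℝ (Fin (m + k)))
    (ι : EuclideanSpace ℝ (Fin k) →ₗᵢ[ℝ] EuclideanSpace ℝ (Fin (m + k))) :
    EuclideanSpace ℝ (Fin (m + k)) →L[ℝ] EuclideanSpace ℝ (Fin (m + k)) :=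
  (ι'.toContinuousLinearMap.coprod (-ι.toContinuousLinearMap)).comp
    (EuclideanSpace.finAddEquivProd (𝕜 := ℝ) (n := m) (m := k)).toContinuousLinearMap

theorem isometryDiff_apply {m k : ℕ}
    (ι' : EuclideanSpace ℝ (Fin m) →ₗᵢ[ℝ] EuclideanSpace ℝ (Fin (m + k)))
    (ι : EuclideanSpace ℝ (Fin k) →ₗᵢ[ℝ] EuclideanSpace ℝ (Fin (m + k)))
    (z : EuclideanSpace ℝ (Fin (m + k))) :
    isometryDiff ι' ι z =
      ι' (EuclideanSpace.finAddEquivProd z).1 - ι (EuclideanSpace.finAddEquivProd z).2 := by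
  simp [isometryDiff, sub_eq_add_neg]

theorem norm_isometryDiff_le {m k : ℕ}
    (ι' : EuclideanSpace ℝ (Fin m) →ₗᵢ[ℝ] EuclideanSpace ℝ (Fin (m + k)))
    (ι : EuclideanSpace ℝ (Fin k) →ₗᵢ[ℝ] EuclideanSpace ℝ (Fin (m + k))) :
    ‖isometryDiff ι' ι‖ ≤ 2 :=
  ContinuousLinearMap.opNorm_le_bound _ (by norm_num) fun z => by
    rw [isometryDiff_apply]
    refine (norm_sub_le _ _).trans ?_
    rw [LinearIsometry.norm_map, LinearIsometry.norm_map, two_mul]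
    exact add_le_add (EuclideanSpace.norm_finAddEquivProd_fst_le z)
      (EuclideanSpace.norm_finAddEquivProd_snd_le z)

theorem abs_det_isometryDiff_le {m k : ℕ}
    (ι' : EuclideanSpace ℝ (Fin m) →ₗᵢ[ℝ] EuclideanSpace ℝ (Fin (m + k)))
    (ι : EuclideanSpace ℝ (Fin k) →ₗᵢ[ℝ] EuclideanSpace ℝ (Fin (m + k))) :
    |(isometryDiff ι' ι).det| ≤ 1 := by
  refine (abs_det_le_prod_norm _).trans (Finset.prod_le_one (fun _ _ => norm_nonneg _) fun i _ => ?_)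
  rw [isometryDiff_apply]
  have h := EuclideanSpace.norm_sq_finAddEquivProd (EuclideanSpace.basisFun (Fin (m + k)) ℝ i)
  rw [OrthonormalBasis.norm_eq_one] at h
  refine (norm_sub_le _ _).trans ?_
  rw [LinearIsometry.norm_map, LinearIsometry.norm_map]
  have h0 : (EuclideanSpace.finAddEquivProd (EuclideanSpace.basisFun (Fin (m + k)) ℝ i)).1 = 0 ∨
      (EuclideanSpace.finAddEquivProd (EuclideanSpace.basisFun (Fin (m + k)) ℝ i)).2 = 0 := by
    induction i using Fin.addCases with
    | left i =>
      right
      ext j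
      change (EuclideanSpace.basisFun (Fin (m + k)) ℝ (Fin.castAdd k i)) (Fin.natAdd m j) = 0
      simp [Fin.ext_iff]
      omega
    | right i =>
      left
      ext j
      change (EuclideanSpace.basisFun (Fin (m + k)) ℝ (Fin.natAdd m i)) (Fin.castAdd k j) = 0
      simp [Fin.ext_iff]
      omega
  rcases h0 with h0 | h0
  · rw [h0] at h ⊢
    simp only [norm_zero, zero_add] at h ⊢
    exact le_of_sq_le_sq (by nlinarith) zero_le_one
  · rw [h0] at h ⊢
    simp only [norm_zero, add_zero] at h ⊢
    exact le_of_sq_le_sq (by nlinarith) zero_le_one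

theorem ContinuousLinearMap.exists_eq_linearIsometry_comp {k : ℕ} {F : Type*}
    [NormedAddCommGroup F] [InnerProductSpace ℝ F] (B : EuclideanSpace ℝ (Fin k) →L[ℝ] F)
    (hB : Function.Injective B) :
    ∃ (ι : EuclideanSpace ℝ (Fin k) →ₗᵢ[ℝ] F)
      (B' : EuclideanSpace ℝ (Fin k) ≃L[ℝ] EuclideanSpace ℝ (Fin k)), ∀ x, B x = ι (B' x) := by
  let e₁ := LinearEquiv.ofInjective (B : EuclideanSpace ℝ (Fin k) →ₗ[ℝ] F) hB
  have hfin : Module.finrank ℝ (LinearMap.range (B : EuclideanSpace ℝ (Fin k) →ₗ[ℝ] F)) = k := by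
    rw [← e₁.finrank_eq]; simp
  let e₂ := ((stdOrthonormalBasis ℝ
    (LinearMap.range (B : EuclideanSpace ℝ (Fin k) →ₗ[ℝ] F))).reindex (finCongr hfin)).repr
  refine ⟨(LinearMap.range (B : EuclideanSpace ℝ (Fin k) →ₗ[ℝ] F)).subtypeₗᵢ.comp
    e₂.symm.toLinearIsometry, (e₁.trans e₂.toLinearEquiv).toContinuousLinearEquiv, fun x => ?_⟩
  have : e₂.symm (e₂ (e₁ x)) = e₁ x := e₂.symm_apply_apply _
  change B x = (e₂.symm (e₂ (e₁ x)) : F)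
  rw [this]
  rfl

open scoped NNReal in
/-- A map decomposes, on the set where its derivative is injective, into countably many
nearly isometric pieces. -/
theorem exists_nearly_isometric_charts {k n : ℕ}
    (ι₀ : EuclideanSpace ℝ (Fin k) →ₗᵢ[ℝ] EuclideanSpace ℝ (Fin n))
    {F : EuclideanSpace ℝ (Fin k) → EuclideanSpace ℝ (Fin n)} (hF : Continuous F)
    {δ : ℝ≥0} (hδ : 0 < δ) :
    ∃ (f : ℕ → EuclideanSpace ℝ (Fin k) → EuclideanSpace ℝ (Fin n))
      (V : ℕ → Set (EuclideanSpace ℝ (Fin k)))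
      (ι : ℕ → EuclideanSpace ℝ (Fin k) →ₗᵢ[ℝ] EuclideanSpace ℝ (Fin n)),
      (∀ b, MeasurableSet (V b)) ∧ (∀ b, Continuous (f b)) ∧
      (∀ b, ApproximatesLinearOn (f b) (ι b).toContinuousLinearMap (V b) δ) ∧
      F '' {v | DifferentiableAt ℝ F v ∧ Function.Injective (fderiv ℝ F v)} ⊆
        ⋃ b, f b '' V b := by
  set s := {v | DifferentiableAt ℝ F v ∧ Function.Injective (fderiv ℝ F v)} with hs
  have hsm : MeasurableSet s :=
    (measurableSet_of_differentiableAt ℝ F).inter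
      (measurable_fderiv ℝ F ContinuousLinearMap.isOpen_injective.measurableSet)
  rcases s.eq_empty_or_nonempty with he | hne
  · refine ⟨fun _ => F, fun _ => ∅, fun _ => ι₀, fun _ => .empty, fun _ => hF, fun _ => ?_, ?_⟩
    · simp [ApproximatesLinearOn]
    · rw [he]; simp
  have hdec : ∀ B : EuclideanSpace ℝ (Fin k) →L[ℝ] EuclideanSpace ℝ (Fin n),
      ∃ (ι : EuclideanSpace ℝ (Fin k) →ₗᵢ[ℝ] EuclideanSpace ℝ (Fin n))
        (B' : EuclideanSpace ℝ (Fin k) ≃L[ℝ] EuclideanSpace ℝ (Fin k)),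
        Function.Injective B → ∀ x, B x = ι (B' x) := fun B => by
    by_cases h : Function.Injective B
    · obtain ⟨ι, B', hB⟩ := B.exists_eq_linearIsometry_comp h
      exact ⟨ι, B', fun _ => hB⟩
    · exact ⟨ι₀, .refl ℝ _, fun h' => (h h').elim⟩
  choose ι B' hB' using hdec
  obtain ⟨t, A, -, htm, hcov, happ, hA⟩ := exists_partition_approximatesLinearOn_of_hasFDerivWithinAt
    F s (fderiv ℝ F) (fun x hx => hx.1.hasFDerivAt.hasFDerivWithinAt)
    (fun B => δ / (‖((B' B).symm : EuclideanSpace ℝ (Fin k) →L[ℝ] EuclideanSpace ℝ (Fin k))‖₊ + 1))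
    (fun B => by positivity)
  have hAinj : ∀ b, Function.Injective (A b) := fun b => by
    obtain ⟨y, hy, h⟩ := hA hne b
    rw [h]; exact hy.2
  refine ⟨fun b => F ∘ (B' (A b)).symm, fun b => (B' (A b)).symm ⁻¹' (s ∩ t b), fun b => ι (A b),
    fun b => (B' (A b)).symm.continuous.measurable (hsm.inter (htm b)),
    fun b => hF.comp (B' (A b)).symm.continuous, fun b x hx y hy => ?_, ?_⟩
  · have h := happ b _ hx _ hy
    have e : A b ((B' (A b)).symm x - (B' (A b)).symm y) = ι (A b) (x - y) := by
      rw [hB' _ (hAinj b), ← map_sub, ContinuousLinearEquiv.apply_symm_apply]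
    rw [e] at h
    refine h.trans ?_
    rw [← map_sub]
    have h2 := ((B' (A b)).symm : EuclideanSpace ℝ (Fin k) →L[ℝ]
      EuclideanSpace ℝ (Fin k)).le_opNorm (x - y)
    rw [ContinuousLinearEquiv.coe_coe] at h2
    push_cast
    set c := ‖((B' (A b)).symm : EuclideanSpace ℝ (Fin k) →L[ℝ] EuclideanSpace ℝ (Fin k))‖
    have hc : 0 ≤ c := norm_nonneg _
    calc (δ : ℝ) / (c + 1) * ‖(B' (A b)).symm (x - y)‖ ≤ δ / (c + 1) * (c * ‖x - y‖) := by gcongr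
      _ ≤ δ / (c + 1) * ((c + 1) * ‖x - y‖) := by gcongr; linarith
      _ = δ * ‖x - y‖ := by field_simp
  · rintro _ ⟨v, hv, rfl⟩
    obtain ⟨b, hb⟩ := mem_iUnion.1 (hcov hv)
    exact mem_iUnion.2 ⟨b, B' (A b) v, by simpa using ⟨hv, hb⟩, by simp⟩

open scoped NNReal in
theorem ApproximatesLinearOn.dist_le_of_linearIsometry {E F : Type*} [NormedAddCommGroup E]
    [NormedSpace ℝ E] [NormedAddCommGroup F] [NormedSpace ℝ F] {f : E → F} {ι : E →ₗᵢ[ℝ] F}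
    {V : Set E} {δ : ℝ≥0} (hf : ApproximatesLinearOn f ι.toContinuousLinearMap V δ) (hδ : δ < 1)
    {x y : E} (hx : x ∈ V) (hy : y ∈ V) : dist x y ≤ ((1 - δ)⁻¹ : ℝ≥0) * dist (f x) (f y) := by
  have h := hf x hx y hy
  have h1 : ‖x - y‖ ≤ ‖f x - f y‖ + δ * ‖x - y‖ := by
    calc ‖x - y‖ = ‖ι (x - y)‖ := (ι.norm_map _).symm
      _ = ‖(f x - f y) - (f x - f y - ι (x - y))‖ := by congr 1; abel
      _ ≤ ‖f x - f y‖ + ‖f x - f y - ι (x - y)‖ := norm_sub_le _ _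
      _ ≤ _ := by gcongr; exact h
  have h2 : (0 : ℝ) < 1 - δ := by simpa using hδ
  rw [dist_eq_norm, dist_eq_norm, NNReal.coe_inv, NNReal.coe_sub hδ.le, NNReal.coe_one,
    inv_mul_eq_div, le_div_iff₀ h2]
  linarith

open scoped NNReal in
theorem ApproximatesLinearOn.injOn_of_linearIsometry {E F : Type*} [NormedAddCommGroup E]
    [NormedSpace ℝ E] [NormedAddCommGroup F] [NormedSpace ℝ F] {f : E → F} {ι : E →ₗᵢ[ℝ] F}
    {V : Set E} {δ : ℝ≥0} (hf : ApproximatesLinearOn f ι.toContinuousLinearMap V δ) (hδ : δ < 1) :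
    InjOn f V := fun x hx y hy hxy => by
  have h := hf.dist_le_of_linearIsometry hδ hx hy
  rw [hxy, dist_self, mul_zero] at h
  exact dist_le_zero.1 h

open scoped NNReal in
/-- A Borel set covered by countably many Lipschitz images decomposes into countably many
disjoint nearly isometric pieces, up to images of points where the derivative fails to be
injective. -/
theorem exists_disjoint_nearly_isometric_charts {k n : ℕ}
    (ι₀ : EuclideanSpace ℝ (Fin k) →ₗᵢ[ℝ] EuclideanSpace ℝ (Fin n))
    {S : Set (EuclideanSpace ℝ (Fin n))} (hS : MeasurableSet S)
    {F : ℕ → EuclideanSpace ℝ (Fin k) → EuclideanSpace ℝ (Fin n)} (hF : ∀ i, Continuous (F i))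
    (hcov : S ⊆ ⋃ i, range (F i)) {δ : ℝ≥0} (hδ : 0 < δ) (hδ1 : δ < 1) :
    ∃ (f : ℕ → EuclideanSpace ℝ (Fin k) → EuclideanSpace ℝ (Fin n))
      (V : ℕ → Set (EuclideanSpace ℝ (Fin k)))
      (ι : ℕ → EuclideanSpace ℝ (Fin k) →ₗᵢ[ℝ] EuclideanSpace ℝ (Fin n)),
      (∀ b, MeasurableSet (V b)) ∧ (∀ b, Continuous (f b)) ∧
      (∀ b, ApproximatesLinearOn (f b) (ι b).toContinuousLinearMap (V b) δ) ∧
      (∀ b, f b '' V b ⊆ S) ∧ Pairwise (Function.onFun Disjoint fun b => f b '' V b) ∧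
      S ⊆ (⋃ b, f b '' V b) ∪
        ⋃ i, F i '' {v | ¬ (DifferentiableAt ℝ (F i) v ∧ Function.Injective (fderiv ℝ (F i) v))} := by
  choose f V ι hV hf happ hc using fun i => exists_nearly_isometric_charts ι₀ (hF i) hδ
  let f' := fun c : ℕ => f c.unpair.1 c.unpair.2
  let W := fun c : ℕ => V c.unpair.1 c.unpair.2 ∩ f' c ⁻¹' S
  have hf' : ∀ c, Continuous (f' c) := fun c => hf _ _
  have hW : ∀ c, MeasurableSet (W c) := fun c => (hV _ _).inter ((hf' c).measurable hS)
  have hWapp : ∀ c, ApproximatesLinearOn (f' c) (ι c.unpair.1 c.unpair.2).toContinuousLinearMap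
      (W c) δ := fun c => (happ _ _).mono_set inter_subset_left
  have hWim : ∀ c, MeasurableSet (f' c '' W c) := fun c =>
    (hW c).image_of_continuousOn_injOn (hf' c).continuousOn
      ((hWapp c).injOn_of_linearIsometry hδ1)
  let D := disjointed fun c => f' c '' W c
  have hD : ∀ c, MeasurableSet (D c) := MeasurableSet.disjointed hWim
  have him : ∀ c, f' c '' (W c ∩ f' c ⁻¹' D c) = D c := fun c => by
    rw [image_inter_preimage]
    exact inter_eq_right.2 (disjointed_subset _ c)
  refine ⟨f', fun c => W c ∩ f' c ⁻¹' D c, fun c => ι c.unpair.1 c.unpair.2,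
    fun c => (hW c).inter ((hf' c).measurable (hD c)), hf',
    fun c => (hWapp c).mono_set inter_subset_left, ?_, ?_, ?_⟩
  · rintro c _ ⟨x, hx, rfl⟩
    exact hx.1.2
  · simp only [him]
    exact disjoint_disjointed _
  · simp only [him]
    have : ⋃ c, D c = ⋃ c, f' c '' W c := iUnion_disjointed
    rw [this]
    intro x hx
    obtain ⟨i, v, rfl⟩ := mem_iUnion.1 (hcov hx)
    by_cases hv : DifferentiableAt ℝ (F i) v ∧ Function.Injective (fderiv ℝ (F i) v)
    · left
      obtain ⟨b, u, hu, hub⟩ := mem_iUnion.1 (hc i (mem_image_of_mem _ hv))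
      refine mem_iUnion.2 ⟨Nat.pair i b, u, ⟨by simpa using hu, ?_⟩, ?_⟩
      · simpa [f', hub] using hx
      · simpa [f'] using hub
    · exact .inr (mem_iUnion.2 ⟨i, v, hv, rfl⟩)

open scoped NNReal in
/-- A nearly isometric parametrization expands the normalized Hausdorff measure by a factor
close to one. -/
theorem volume_inter_preimage_le_of_approximatesLinearOn {k n : ℕ}
    {f : EuclideanSpace ℝ (Fin k) → EuclideanSpace ℝ (Fin n)}
    {V : Set (EuclideanSpace ℝ (Fin k))}
    {ι : EuclideanSpace ℝ (Fin k) →ₗᵢ[ℝ] EuclideanSpace ℝ (Fin n)} {δ : ℝ≥0}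
    (hf : ApproximatesLinearOn f ι.toContinuousLinearMap V δ) (hδ : δ < 1)
    (Y : Set (EuclideanSpace ℝ (Fin n))) :
    volume (V ∩ f ⁻¹' Y) ≤ (((1 - δ)⁻¹ ^ k : ℝ≥0) : ENNReal) *
      stdHausdorff k (EuclideanSpace ℝ (Fin n)) (Y ∩ f '' V) := by
  have hinj := hf.injOn_of_linearIsometry hδ
  have hinv : ∀ x ∈ V, Function.invFunOn f V (f x) = x := fun x hx =>
    hinj.leftInvOn_invFunOn hx
  have hlip : LipschitzOnWith (1 - δ)⁻¹ (Function.invFunOn f V) (Y ∩ f '' V) := by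
    refine LipschitzOnWith.of_dist_le_mul ?_
    rintro _ ⟨-, x, hx, rfl⟩ _ ⟨-, y, hy, rfl⟩
    rw [hinv x hx, hinv y hy]
    exact hf.dist_le_of_linearIsometry hδ hx hy
  have him : V ∩ f ⁻¹' Y ⊆ Function.invFunOn f V '' (Y ∩ f '' V) := fun x hx =>
    ⟨f x, ⟨hx.2, x, hx.1, rfl⟩, hinv x hx.1⟩
  have h := (measure_mono him).trans (hlip.hausdorffMeasure_image_le (d := k) (Nat.cast_nonneg k))
  rw [← stdHausdorff_eq_volume, stdHausdorff, stdHausdorff, Measure.smul_apply,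
    Measure.smul_apply, smul_eq_mul, smul_eq_mul, mul_left_comm]
  gcongr
  rw [ENNReal.rpow_natCast, ← ENNReal.coe_pow] at h
  exact h

open scoped NNReal in
theorem sum_map_le_stdHausdorff {k n : ℕ}
    {f : ℕ → EuclideanSpace ℝ (Fin k) → EuclideanSpace ℝ (Fin n)}
    {V : ℕ → Set (EuclideanSpace ℝ (Fin k))}
    {ι : ℕ → EuclideanSpace ℝ (Fin k) →ₗᵢ[ℝ] EuclideanSpace ℝ (Fin n)} {δ : ℝ≥0} (hδ : δ < 1)
    {S : Set (EuclideanSpace ℝ (Fin n))}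
    (hV : ∀ b, MeasurableSet (V b)) (hfc : ∀ b, Continuous (f b))
    (hf : ∀ b, ApproximatesLinearOn (f b) (ι b).toContinuousLinearMap (V b) δ)
    (hfS : ∀ b, f b '' V b ⊆ S) (hdisj : Pairwise (Function.onFun Disjoint fun b => f b '' V b)) :
    Measure.sum (fun b => (volume.restrict (V b)).map (f b)) ≤
      (((1 - δ)⁻¹ ^ k : ℝ≥0) : ENNReal) •
        (stdHausdorff k (EuclideanSpace ℝ (Fin n))).restrict S := by
  refine Measure.le_iff.2 fun Y hY => ?_
  rw [Measure.sum_apply _ hY, Measure.smul_apply, smul_eq_mul, Measure.restrict_apply hY]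
  have him : ∀ b, MeasurableSet (f b '' V b) := fun b =>
    (hV b).image_of_continuousOn_injOn (hfc b).continuousOn ((hf b).injOn_of_linearIsometry hδ)
  calc ∑' b, (volume.restrict (V b)).map (f b) Y
      ≤ ∑' b, (((1 - δ)⁻¹ ^ k : ℝ≥0) : ENNReal) *
          stdHausdorff k (EuclideanSpace ℝ (Fin n)) (Y ∩ f b '' V b) := by
        refine ENNReal.tsum_le_tsum fun b => ?_
        rw [Measure.map_apply (hfc b).measurable hY,
          Measure.restrict_apply ((hfc b).measurable hY), inter_comm]
        exact volume_inter_preimage_le_of_approximatesLinearOn (hf b) hδ Y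
    _ = (((1 - δ)⁻¹ ^ k : ℝ≥0) : ENNReal) *
          stdHausdorff k (EuclideanSpace ℝ (Fin n)) (⋃ b, Y ∩ f b '' V b) := by
        rw [ENNReal.tsum_mul_left, measure_iUnion _ fun b => hY.inter (him b)]
        exact fun a b hab => (hdisj hab).mono inter_subset_right inter_subset_right
    _ ≤ _ := by
        gcongr
        exact iUnion_subset fun b => inter_subset_inter_right _ (hfS b)

open scoped NNReal in
theorem approximatesLinearOn_isometryDiff {m k : ℕ}
    {g : EuclideanSpace ℝ (Fin m) → EuclideanSpace ℝ (Fin (m + k))}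
    {f : EuclideanSpace ℝ (Fin k) → EuclideanSpace ℝ (Fin (m + k))}
    {U : Set (EuclideanSpace ℝ (Fin m))} {V : Set (EuclideanSpace ℝ (Fin k))}
    {ι' : EuclideanSpace ℝ (Fin m) →ₗᵢ[ℝ] EuclideanSpace ℝ (Fin (m + k))}
    {ι : EuclideanSpace ℝ (Fin k) →ₗᵢ[ℝ] EuclideanSpace ℝ (Fin (m + k))} {δ : ℝ≥0}
    (hg : ApproximatesLinearOn g ι'.toContinuousLinearMap U δ)
    (hf : ApproximatesLinearOn f ι.toContinuousLinearMap V δ) :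
    ApproximatesLinearOn
      (fun z => g (EuclideanSpace.finAddEquivProd z).1 - f (EuclideanSpace.finAddEquivProd z).2)
      (isometryDiff ι' ι) (EuclideanSpace.finAddEquivProd ⁻¹' U ×ˢ V) (2 * δ) := by
  intro x hx y hy
  have h1 := hg _ hx.1 _ hy.1
  have h2 := hf _ hx.2 _ hy.2
  have h3 := EuclideanSpace.norm_finAddEquivProd_fst_le (x - y)
  have h4 := EuclideanSpace.norm_finAddEquivProd_snd_le (x - y)
  rw [isometryDiff_apply]
  rw [map_sub, Prod.fst_sub] at h3
  rw [map_sub, Prod.snd_sub] at h4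
  rw [map_sub, Prod.fst_sub, Prod.snd_sub]
  set x' := EuclideanSpace.finAddEquivProd (𝕜 := ℝ) x
  set y' := EuclideanSpace.finAddEquivProd (𝕜 := ℝ) y
  have e : g x'.1 - f x'.2 - (g y'.1 - f y'.2) - (ι' (x'.1 - y'.1) - ι (x'.2 - y'.2)) =
      (g x'.1 - g y'.1 - ι' (x'.1 - y'.1)) - (f x'.2 - f y'.2 - ι (x'.2 - y'.2)) := by abel
  rw [e]
  push_cast
  calc _ ≤ ‖g x'.1 - g y'.1 - ι' (x'.1 - y'.1)‖ + ‖f x'.2 - f y'.2 - ι (x'.2 - y'.2)‖ :=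
        norm_sub_le _ _
    _ ≤ δ * ‖x'.1 - y'.1‖ + δ * ‖x'.2 - y'.2‖ := add_le_add h1 h2
    _ ≤ δ * ‖x - y‖ + δ * ‖x - y‖ := by gcongr
    _ = _ := by ring

theorem lintegral_image_le_mul_lintegral_comp {n : ℕ}
    {G : EuclideanSpace ℝ (Fin n) → EuclideanSpace ℝ (Fin n)} (hG : Measurable G)
    {Q : Set (EuclideanSpace ℝ (Fin n))} {c : ENNReal}
    (h : ∀ s ⊆ Q, volume (G '' s) ≤ c * volume s) {Φ : EuclideanSpace ℝ (Fin n) → ENNReal}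
    (hΦ : Measurable Φ) :
    ∫⁻ w in G '' Q, Φ w ≤ c * ∫⁻ z in Q, Φ (G z) := by
  have hle : volume.restrict (G '' Q) ≤ c • (volume.restrict Q).map G := by
    refine Measure.le_iff.2 fun Y hY => ?_
    rw [Measure.restrict_apply hY, Measure.smul_apply, smul_eq_mul, Measure.map_apply hG hY,
      Measure.restrict_apply (hG hY), inter_comm (G ⁻¹' Y), inter_comm Y, ← image_inter_preimage]
    exact h _ inter_subset_left
  refine (lintegral_mono' hle le_rfl).trans ?_
  rw [lintegral_smul_measure, lintegral_map hΦ hG, smul_eq_mul]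

/-- Points where one of two Lipschitz maps has no injective derivative contribute nothing to
the difference set. -/
theorem volume_sub_image_eq_zero {m k : ℕ} {K K' : NNReal}
    {g : EuclideanSpace ℝ (Fin m) → EuclideanSpace ℝ (Fin (m + k))}
    {f : EuclideanSpace ℝ (Fin k) → EuclideanSpace ℝ (Fin (m + k))}
    (hg : LipschitzWith K' g) (hf : LipschitzWith K f) :
    volume ((fun z => g (EuclideanSpace.finAddEquivProd z).1 -
        f (EuclideanSpace.finAddEquivProd z).2) ''
      {z | ¬ ((DifferentiableAt ℝ g (EuclideanSpace.finAddEquivProd z).1 ∧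
          Function.Injective (fderiv ℝ g (EuclideanSpace.finAddEquivProd z).1)) ∧
        (DifferentiableAt ℝ f (EuclideanSpace.finAddEquivProd z).2 ∧
          Function.Injective (fderiv ℝ f (EuclideanSpace.finAddEquivProd z).2)))}) = 0 := by
  let L := EuclideanSpace.finAddEquivProd (𝕜 := ℝ) (n := m) (m := k)
  have hL := L.lipschitz
  have hG := (hg.comp (LipschitzWith.prod_fst.comp hL)).sub
    (hf.comp (LipschitzWith.prod_snd.comp hL))
  refine LipschitzWith.volume_image_eq_zero hG fun z hz hdiff => ?_
  by_contra hdet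
  apply hz
  set G := fun z => g (L z).1 - f (L z).2 with hGdef
  change DifferentiableAt ℝ G z at hdiff
  change (fderiv ℝ G z).det ≠ 0 at hdet
  have hinj : Function.Injective (fderiv ℝ G z) :=
    LinearMap.ker_eq_bot.1 (by
      by_contra hker
      exact hdet (LinearMap.det_eq_zero_iff_ker_ne_bot.2 hker))
  have hz' : L.symm ((L z).1, (L z).2) = z := L.symm_apply_apply z
  constructor
  · have h1 : HasFDerivAt (fun u => L.symm (u, (L z).2)) ((L.symm : _ →L[ℝ] _).comp
        (ContinuousLinearMap.inl ℝ (EuclideanSpace ℝ (Fin m)) (EuclideanSpace ℝ (Fin k))))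
        (L z).1 :=
      L.symm.hasFDerivAt.comp (L z).1 (hasFDerivAt_prodMk_left (𝕜 := ℝ) (L z).1 (L z).2)
    have h2 : HasFDerivAt g ((fderiv ℝ G z).comp ((L.symm : _ →L[ℝ] _).comp
        (ContinuousLinearMap.inl ℝ (EuclideanSpace ℝ (Fin m)) (EuclideanSpace ℝ (Fin k)))))
        (L z).1 := by
      have h3 := HasFDerivAt.comp (L z).1 (g := G) (by rw [hz']; exact hdiff.hasFDerivAt) h1
      have h4 := h3.add_const (f (L z).2)
      refine h4.congr_of_eventuallyEq (.of_forall fun u => ?_)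
      simp [hGdef]
    refine ⟨h2.differentiableAt, ?_⟩
    rw [h2.fderiv]
    exact hinj.comp (L.symm.injective.comp LinearMap.inl_injective)
  · have h1 : HasFDerivAt (fun v => L.symm ((L z).1, v)) ((L.symm : _ →L[ℝ] _).comp
        (ContinuousLinearMap.inr ℝ (EuclideanSpace ℝ (Fin m)) (EuclideanSpace ℝ (Fin k))))
        (L z).2 :=
      L.symm.hasFDerivAt.comp (L z).2 (hasFDerivAt_prodMk_right (𝕜 := ℝ) (L z).1 (L z).2)
    have h2 : HasFDerivAt f (-(fderiv ℝ G z).comp ((L.symm : _ →L[ℝ] _).comp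
        (ContinuousLinearMap.inr ℝ (EuclideanSpace ℝ (Fin m)) (EuclideanSpace ℝ (Fin k)))))
        (L z).2 := by
      have h3 := HasFDerivAt.comp (L z).2 (g := G) (by rw [hz']; exact hdiff.hasFDerivAt) h1
      have h4 := h3.const_sub (g (L z).1)
      refine h4.congr_of_eventuallyEq (.of_forall fun u => ?_)
      simp [hGdef]
    refine ⟨h2.differentiableAt, ?_⟩
    rw [h2.fderiv]
    exact neg_injective.comp (hinj.comp (L.symm.injective.comp LinearMap.inr_injective))

theorem lintegral_preimage_finAddEquivProd {m k : ℕ} {U : Set (EuclideanSpace ℝ (Fin m))}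
    {V : Set (EuclideanSpace ℝ (Fin k))}
    {h : EuclideanSpace ℝ (Fin m) × EuclideanSpace ℝ (Fin k) → ENNReal} (hh : Measurable h) :
    ∫⁻ z in EuclideanSpace.finAddEquivProd ⁻¹' U ×ˢ V, h (EuclideanSpace.finAddEquivProd z) =
      ∫⁻ u in U, ∫⁻ v in V, h (u, v) := by
  rw [(EuclideanSpace.volume_preserving_finAddEquivProd m k).setLIntegral_comp_preimage_emb
    (EuclideanSpace.finAddEquivProd (𝕜 := ℝ)).toHomeomorph.measurableEmbedding,
    Measure.volume_eq_prod, ← Measure.prod_restrict, lintegral_prod _ hh.aemeasurable]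

open scoped NNReal in
theorem eventually_inv_one_sub_pow_le (j : ℕ) {c : ℝ≥0} (hc : 1 < c) :
    ∀ᶠ δ : ℝ≥0 in nhds 0, (1 - δ)⁻¹ ^ j ≤ c := by
  have h : ContinuousAt (fun δ : ℝ≥0 => (1 - δ)⁻¹ ^ j) 0 := by
    refine ContinuousAt.pow (ContinuousAt.inv₀ ?_ (by simp)) j
    exact (continuous_const.sub continuous_id).continuousAt
  exact (h.eventually_lt_const (by simpa using hc)).mono fun _ h => h.le

open scoped NNReal in
/-- The integral over a difference set of rectifiable sets is controlled by the double integral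
over the two sets. -/
theorem lintegral_le_mul_lintegral_lintegral_sub {m k : ℕ}
    {B S S' : Set (EuclideanSpace ℝ (Fin (m + k)))} (hS : MeasurableSet S)
    (hS' : MeasurableSet S')
    {F : ℕ → EuclideanSpace ℝ (Fin k) → EuclideanSpace ℝ (Fin (m + k))}
    {F' : ℕ → EuclideanSpace ℝ (Fin m) → EuclideanSpace ℝ (Fin (m + k))}
    {K K' : ℕ → ℝ≥0} (hF : ∀ i, LipschitzWith (K i) (F i))
    (hF' : ∀ i, LipschitzWith (K' i) (F' i))
    (hcov : S ⊆ ⋃ i, range (F i)) (hcov' : S' ⊆ ⋃ i, range (F' i))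
    (hB : ∀ w ∈ B, ∃ x ∈ S', ∃ y ∈ S, x - y = w)
    {Φ : EuclideanSpace ℝ (Fin (m + k)) → ENNReal} (hΦ : Measurable Φ) {c : ℝ≥0} (hc : 1 < c) :
    ∫⁻ w in B, Φ w ≤ c ^ 3 *
      ∫⁻ x in S', (∫⁻ y in S, Φ (x - y) ∂(stdHausdorff k (EuclideanSpace ℝ (Fin (m + k)))))
        ∂(stdHausdorff m (EuclideanSpace ℝ (Fin (m + k)))) := by
  obtain ⟨δ₀, hδ₀, hdet⟩ := exists_addHaar_image_le_mul_of_abs_det_le_one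
    (volume : Measure (EuclideanSpace ℝ (Fin (m + k)))) 2 hc
  obtain ⟨δ, hδ, hδ1, hδ2, hδk, hδm⟩ : ∃ δ : ℝ≥0, 0 < δ ∧ δ < 1 ∧ 2 * δ ≤ δ₀ ∧
      (1 - δ)⁻¹ ^ k ≤ c ∧ (1 - δ)⁻¹ ^ m ≤ c := by
    have h2 : ∀ᶠ δ : ℝ≥0 in nhds 0, 2 * δ ≤ δ₀ := by
      have h : ContinuousAt (fun δ : ℝ≥0 => 2 * δ) 0 := by fun_prop
      exact (h.eventually_lt_const (by simpa using hδ₀)).mono fun _ h => h.le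
    have h := (((eventually_lt_nhds one_pos).and h2).and ((eventually_inv_one_sub_pow_le k hc).and
      (eventually_inv_one_sub_pow_le m hc))).filter_mono
        (nhdsWithin_le_nhds (s := Ioi (0 : ℝ≥0)))
    obtain ⟨δ, ⟨⟨h1, h2⟩, h3, h4⟩, h5⟩ := (h.and self_mem_nhdsWithin).exists
    exact ⟨δ, h5, h1, h2, h3, h4⟩
  let L := EuclideanSpace.finAddEquivProd (𝕜 := ℝ) (n := m) (m := k)
  let ι₀ : EuclideanSpace ℝ (Fin k) →ₗᵢ[ℝ] EuclideanSpace ℝ (Fin (m + k)) :=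
    ⟨L.symm.toLinearMap.comp (LinearMap.inr ℝ _ _), fun v => by
      have h := EuclideanSpace.norm_sq_finAddEquivProd (L.symm (0, v))
      change ‖(L (L.symm (0, v))).1‖ ^ 2 + ‖(L (L.symm (0, v))).2‖ ^ 2 = _ at h
      rw [L.apply_symm_apply] at h
      simp only [norm_zero, ne_eq, OfNat.ofNat_ne_zero, not_false_eq_true, zero_pow,
        zero_add] at h
      exact ((sq_eq_sq₀ (norm_nonneg _) (norm_nonneg _)).1 h).symm⟩
  let ι₀' : EuclideanSpace ℝ (Fin m) →ₗᵢ[ℝ] EuclideanSpace ℝ (Fin (m + k)) :=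
    ⟨L.symm.toLinearMap.comp (LinearMap.inl ℝ _ _), fun v => by
      have h := EuclideanSpace.norm_sq_finAddEquivProd (L.symm (v, 0))
      change ‖(L (L.symm (v, 0))).1‖ ^ 2 + ‖(L (L.symm (v, 0))).2‖ ^ 2 = _ at h
      rw [L.apply_symm_apply] at h
      simp only [norm_zero, ne_eq, OfNat.ofNat_ne_zero, not_false_eq_true, zero_pow,
        add_zero] at h
      exact ((sq_eq_sq₀ (norm_nonneg _) (norm_nonneg _)).1 h).symm⟩
  obtain ⟨f, V, ι, hV, hfc, hf, hfS, hdisj, hSf⟩ := exists_disjoint_nearly_isometric_charts ι₀ hS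
    (fun i => (hF i).continuous) hcov hδ hδ1
  obtain ⟨g, U, ι', hU, hgc, hg, hgS, hdisj', hSg⟩ := exists_disjoint_nearly_isometric_charts ι₀'
    hS' (fun i => (hF' i).continuous) hcov' hδ hδ1
  have hν := sum_map_le_stdHausdorff hδ1 hV hfc hf hfS hdisj
  have hν' := sum_map_le_stdHausdorff hδ1 hU hgc hg hgS hdisj'
  let G := fun (p : ℕ × ℕ) z => g p.1 (L z).1 - f p.2 (L z).2
  let Q := fun p : ℕ × ℕ => L ⁻¹' U p.1 ×ˢ V p.2
  have hGm : ∀ p, Measurable (G p) := fun p =>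
    (((hgc p.1).comp (continuous_fst.comp L.continuous)).sub
      ((hfc p.2).comp (continuous_snd.comp L.continuous))).measurable
  let N := ⋃ p : ℕ × ℕ, (fun z => F' p.1 (L z).1 - F p.2 (L z).2) ''
    {z | ¬ ((DifferentiableAt ℝ (F' p.1) (L z).1 ∧
        Function.Injective (fderiv ℝ (F' p.1) (L z).1)) ∧
      (DifferentiableAt ℝ (F p.2) (L z).2 ∧ Function.Injective (fderiv ℝ (F p.2) (L z).2)))}
  have hN : volume N = 0 :=
    measure_iUnion_null fun p => volume_sub_image_eq_zero (hF' p.1) (hF p.2)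
  have hBsub : B ⊆ (⋃ p, G p '' Q p) ∪ N := by
    intro w hw
    obtain ⟨x, hx, y, hy, rfl⟩ := hB w hw
    rcases hSg hx with hx' | hx'
    · obtain ⟨a, u, hu, rfl⟩ := mem_iUnion.1 hx'
      rcases hSf hy with hy' | hy'
      · obtain ⟨b, v, hv, rfl⟩ := mem_iUnion.1 hy'
        exact .inl (mem_iUnion.2 ⟨(a, b), L.symm (u, v), by simp [Q, hu, hv], by simp [G]⟩)
      · obtain ⟨i, v, hv, rfl⟩ := mem_iUnion.1 hy'
        obtain ⟨j, u', hu'⟩ := mem_iUnion.1 (hcov' hx)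
        refine .inr (mem_iUnion.2 ⟨(j, i), L.symm (u', v), fun h => hv ?_, ?_⟩)
        · simpa only [L.apply_symm_apply] using h.2
        · simp only [L.apply_symm_apply, hu']
    · obtain ⟨j, u, hu, rfl⟩ := mem_iUnion.1 hx'
      obtain ⟨i, v, rfl⟩ := mem_iUnion.1 (hcov hy)
      refine .inr (mem_iUnion.2 ⟨(j, i), L.symm (u, v), fun h => hu ?_, ?_⟩)
      · simpa only [L.apply_symm_apply] using h.1
      · simp only [L.apply_symm_apply]
  have hsub : Measurable fun p : EuclideanSpace ℝ (Fin (m + k)) × EuclideanSpace ℝ (Fin (m + k)) =>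
      Φ (p.1 - p.2) := hΦ.comp measurable_sub
  have hpiece : ∀ a b, ∫⁻ w in G (a, b) '' Q (a, b), Φ w ≤
      c * ∫⁻ u in U a, ∫⁻ v in V b, Φ (g a u - f b v) := by
    intro a b
    refine (lintegral_image_le_mul_lintegral_comp (c := c) (hGm (a, b)) (fun s hs => ?_) hΦ).trans ?_
    · exact hdet _ (norm_isometryDiff_le (ι' a) (ι b)) (abs_det_isometryDiff_le (ι' a) (ι b)) s _
        (((approximatesLinearOn_isometryDiff (hg a) (hf b)).mono_set hs).mono_num hδ2)
    · gcongr
      exact (lintegral_preimage_finAddEquivProd (h := fun q => Φ (g a q.1 - f b q.2))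
        (hΦ.comp ((((hgc a).comp continuous_fst).sub
          ((hfc b).comp continuous_snd)).measurable))).le
  have hinner : ∀ x, ∫⁻ y, Φ (x - y) ∂(Measure.sum fun b => (volume.restrict (V b)).map (f b)) =
      ∑' b, ∫⁻ v in V b, Φ (x - f b v) := fun x => by
    rw [lintegral_sum_measure]
    exact tsum_congr fun b => lintegral_map (hsub.comp measurable_prodMk_left) (hfc b).measurable
  have hmeas : ∀ b, Measurable fun x => ∫⁻ v in V b, Φ (x - f b v) := fun b =>
    Measurable.lintegral_prod_right' (f := fun q : EuclideanSpace ℝ (Fin (m + k)) ×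
      EuclideanSpace ℝ (Fin k) => Φ (q.1 - f b q.2))
      (hΦ.comp ((continuous_fst.sub ((hfc b).comp continuous_snd)).measurable))
  calc ∫⁻ w in B, Φ w ≤ ∫⁻ w in (⋃ p, G p '' Q p) ∪ N, Φ w := lintegral_mono_set hBsub
    _ ≤ (∫⁻ w in ⋃ p, G p '' Q p, Φ w) + ∫⁻ w in N, Φ w := lintegral_union_le _ _ _
    _ = ∫⁻ w in ⋃ p, G p '' Q p, Φ w := by
        rw [Measure.restrict_eq_zero.2 hN, lintegral_zero_measure, add_zero]
    _ ≤ ∑' p, ∫⁻ w in G p '' Q p, Φ w := lintegral_iUnion_le _ _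
    _ = ∑' a, ∑' b, ∫⁻ w in G (a, b) '' Q (a, b), Φ w :=
        ENNReal.tsum_prod (f := fun a b => ∫⁻ w in G (a, b) '' Q (a, b), Φ w)
    _ ≤ ∑' a, ∑' b, c * ∫⁻ u in U a, ∫⁻ v in V b, Φ (g a u - f b v) := by
        gcongr with a b; exact hpiece a b
    _ = c * ∑' a, ∑' b, ∫⁻ u in U a, ∫⁻ v in V b, Φ (g a u - f b v) := by
        simp only [ENNReal.tsum_mul_left]
    _ = c * ∫⁻ x, (∫⁻ y, Φ (x - y) ∂(Measure.sum fun b => (volume.restrict (V b)).map (f b)))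
          ∂(Measure.sum fun a => (volume.restrict (U a)).map (g a)) := by
        congr 1
        rw [lintegral_sum_measure]
        refine tsum_congr fun a => ?_
        simp only [hinner]
        rw [lintegral_map (Measurable.tsum hmeas) (hgc a).measurable]
        exact (lintegral_tsum fun b => ((hmeas b).comp (hgc a).measurable).aemeasurable).symm
    _ ≤ c * ∫⁻ x, (∫⁻ y, Φ (x - y)
            ∂((c : ENNReal) • (stdHausdorff k (EuclideanSpace ℝ (Fin (m + k)))).restrict S))
          ∂((c : ENNReal) • (stdHausdorff m (EuclideanSpace ℝ (Fin (m + k)))).restrict S') := by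
        refine mul_le_mul_right ?_ _
        refine lintegral_mono' (hν'.trans ?_) fun x => lintegral_mono' (hν.trans ?_) le_rfl
        · exact Measure.le_iff'.2 fun s => by
            simp only [Measure.smul_apply, smul_eq_mul]
            gcongr
        · exact Measure.le_iff'.2 fun s => by
            simp only [Measure.smul_apply, smul_eq_mul]
            gcongr
    _ = _ := by
        simp only [lintegral_smul_measure, smul_eq_mul]
        rw [lintegral_const_mul' _ _ ENNReal.coe_ne_top]
        ring

theorem one_le_setLIntegral_ball_mollifier {n : ℕ} {φ : EuclideanSpace ℝ (Fin n) → ℝ}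
    (hφpos : ∀ x, 0 ≤ φ x)
    (hφsupp : ∀ x, x ∉ Metric.closedBall (0 : EuclideanSpace ℝ (Fin n)) 1 → φ x = 0)
    (hφint : ∫ x, φ x = 1) {ε : ℝ} (hε : 0 < ε) :
    1 ≤ ∫⁻ w in Metric.ball (0 : EuclideanSpace ℝ (Fin n)) ε,
      ENNReal.ofReal ((ε ^ n)⁻¹ * φ (ε⁻¹ • w)) := by
  have hint : Integrable φ := by
    by_contra h
    rw [integral_undef h] at hφint
    exact zero_ne_one hφint
  have h1 : ∫ w, (ε ^ n)⁻¹ * φ (ε⁻¹ • w) = 1 := by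
    rw [integral_const_mul, Measure.integral_comp_inv_smul_of_nonneg _ _ hε.le, hφint]
    simp [hε.ne']
  have h2 : ∫⁻ w, ENNReal.ofReal ((ε ^ n)⁻¹ * φ (ε⁻¹ • w)) = 1 := by
    rw [← ofReal_integral_eq_lintegral_ofReal ((hint.comp_smul (inv_ne_zero hε.ne')).const_mul _)
      (.of_forall fun w => mul_nonneg (by positivity) (hφpos _)), h1, ENNReal.ofReal_one]
  have h3 : volume.restrict (Metric.sphere (0 : EuclideanSpace ℝ (Fin n)) ε) = 0 :=
    Measure.restrict_eq_zero.2 (Measure.addHaar_sphere_of_ne_zero _ _ hε.ne')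
  have h4 := lintegral_union_le (μ := volume) (fun w => ENNReal.ofReal ((ε ^ n)⁻¹ * φ (ε⁻¹ • w)))
    (Metric.ball (0 : EuclideanSpace ℝ (Fin n)) ε) (Metric.sphere 0 ε)
  rw [Metric.ball_union_sphere, h3, lintegral_zero_measure, add_zero] at h4
  refine le_trans ?_ h4
  rw [← h2, ← lintegral_indicator Metric.isClosed_closedBall.measurableSet]
  refine lintegral_mono fun w => ?_
  by_cases hw : w ∈ Metric.closedBall (0 : EuclideanSpace ℝ (Fin n)) ε
  · rw [indicator_of_mem hw]
  · rw [hφsupp]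
    · simp
    · rw [mem_closedBall_zero_iff, norm_smul, norm_inv, Real.norm_of_nonneg hε.le,
        inv_mul_le_iff₀ hε, mul_one]
      rwa [mem_closedBall_zero_iff] at hw

end

/-- If every `w` with `|w| < ε` can be written as `x - y` with `x ∈ S*` and `y ∈ S`, where
`S` is covered by countably many `k`-rectifiable sets and `S*` by countably many
`(n-k)`-rectifiable sets, then `∫_{S*} ∫_S φ_ε(x - y) dH^k(y) dH^{n-k}(x) ≥ 1` for a
mollifier `φ_ε(x) = ε⁻ⁿ φ(x/ε)`. -/
theorem lintegral_mollifier_rectifiable_ge_one (n k : ℕ) (hk : 0 < k) (hkn : k < n)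
    (S Sstar : Set (EuclideanSpace ℝ (Fin n)))
    (hSBorel : MeasurableSet S) (hSstarBorel : MeasurableSet Sstar)
    (T : ℕ → Set (EuclideanSpace ℝ (Fin n))) (hT : ∀ i, IsRectifiable k (T i))
    (hScov : S ⊆ ⋃ i, T i)
    (Tstar : ℕ → Set (EuclideanSpace ℝ (Fin n))) (hTstar : ∀ i, IsRectifiable (n - k) (Tstar i))
    (hSstarcov : Sstar ⊆ ⋃ i, Tstar i)
    (φ : EuclideanSpace ℝ (Fin n) → ℝ) (hφsmooth : ContDiff ℝ (⊤ : ℕ∞) φ) (hφpos : ∀ x, 0 ≤ φ x)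
    (hφsupp : ∀ x, x ∉ Metric.closedBall (0 : EuclideanSpace ℝ (Fin n)) 1 → φ x = 0)
    (hφint : ∫ x, φ x ∂(stdHausdorff n _) = 1)
    (ε : ℝ) (hε : 0 < ε)
    (hsurj : ∀ w : EuclideanSpace ℝ (Fin n), ‖w‖ < ε → ∃ x ∈ Sstar, ∃ y ∈ S, x - y = w) :
    1 ≤ ∫⁻ x in Sstar, ∫⁻ y in S,
          ENNReal.ofReal ((ε ^ n)⁻¹ * φ (ε⁻¹ • (x - y))) ∂(stdHausdorff k _)
        ∂(stdHausdorff (n - k) _) := by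
  obtain ⟨m, rfl⟩ : ∃ m, n = m + k := ⟨n - k, by omega⟩
  rw [Nat.add_sub_cancel] at hTstar ⊢
  choose F K A hF hTF using hT
  choose F' K' A' hF' hTF' using hTstar
  have hcov : S ⊆ ⋃ i, Set.range (F i) :=
    hScov.trans (Set.iUnion_mono fun i => (hTF i).trans (Set.image_subset_range _ _))
  have hcov' : Sstar ⊆ ⋃ i, Set.range (F' i) :=
    hSstarcov.trans (Set.iUnion_mono fun i => (hTF' i).trans (Set.image_subset_range _ _))
  rw [stdHausdorff_eq_volume] at hφint
  have hφc : Continuous φ := hφsmooth.continuous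
  have hball := one_le_setLIntegral_ball_mollifier hφpos hφsupp hφint hε
  have hΦ : Measurable fun w : EuclideanSpace ℝ (Fin (m + k)) =>
      ENNReal.ofReal ((ε ^ (m + k))⁻¹ * φ (ε⁻¹ • w)) := by
    have : Continuous fun w : EuclideanSpace ℝ (Fin (m + k)) =>
      (ε ^ (m + k))⁻¹ * φ (ε⁻¹ • w) := by fun_prop
    exact this.measurable.ennreal_ofReal
  set I := ∫⁻ x in Sstar, ∫⁻ y in S,
          ENNReal.ofReal ((ε ^ (m + k))⁻¹ * φ (ε⁻¹ • (x - y))) ∂(stdHausdorff k _)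
        ∂(stdHausdorff m _) with hI
  have key : ∀ c : NNReal, 1 < c → 1 ≤ (c : ENNReal) ^ 3 * I := fun c hc =>
    hball.trans (lintegral_le_mul_lintegral_lintegral_sub hSBorel hSstarBorel hF hF' hcov hcov'
      (fun w hw => hsurj w (mem_ball_zero_iff.1 hw)) hΦ hc)
  have hlim : Filter.Tendsto (fun c : NNReal => (c : ENNReal) ^ 3 * I)
      (nhdsWithin 1 (Set.Ioi 1)) (nhds (1 * I)) := by
    refine ENNReal.Tendsto.mul_const ?_ (.inl one_ne_zero)
    have h : Continuous fun c : NNReal => (c : ENNReal) ^ 3 :=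
      (ENNReal.continuous_pow 3).comp ENNReal.continuous_coe
    simpa using (h.tendsto 1).mono_left nhdsWithin_le_nhds
  rw [one_mul] at hlim
  exact ge_of_tendsto hlim (Filter.eventually_of_mem self_mem_nhdsWithin fun c hc => key c hc)
end
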